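/- arXiv:1001.0554 — 2 statements merged into one kernel-verified Lean document; each statement's English description precedes it below -/
import Mathlib

section
/- Let m ≥ 1 and let s_1, …, s_m be finite signed Borel measures on ℝ with compact support such that Co(supp s_k) = Δ for every k, where Δ is a closed bounded interval. Let V ⊂ ℂ be an open neighborhood of Δ and let f_0, …, f_m be holomorphic functions on V. Suppose there is a holomorphic function F on ℂ ∖ Δ which agrees with f_0(z) + Σ_{k=1}^m f_k(z)·ŝ_k(z) for all z ∈ V ∖ Δ and which satisfies F(z) = O(1/z²) as z → ∞ (i.e. z²·F(z) remains bounded as |z| → ∞). Then Σ_{k=1}^m ∫ f_k(x) ds_k(x) = 0. -/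
open MeasureTheory Set Polynomial Filter

noncomputable section

/-- A signed Borel measure on `ℝ`, represented by a pair of (nonnegative) measures
(a "positive part" and a "negative part"). -/
structure SignedM where
  pos : MeasureTheory.Measure ℝ
  neg : MeasureTheory.Measure ℝ

namespace SignedM

/-- Integral of a complex-valued function against a signed measure. -/
def cintegral (s : SignedM) (f : ℝ → ℂ) : ℂ :=
  (∫ x, f x ∂s.pos) - ∫ x, f x ∂s.neg

/-- Integral of a real-valued function against a signed measure. -/
def rintegral (s : SignedM) (f : ℝ → ℝ) : ℝ :=
  (∫ x, f x ∂s.pos) - ∫ x, f x ∂s.neg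

/-- The Cauchy transform `ŝ(z) = ∫ ds(x)/(z - x)` at a complex point. -/
def cauchy (s : SignedM) (z : ℂ) : ℂ :=
  s.cintegral fun x => (z - (x : ℂ))⁻¹

/-- The Cauchy transform at a real point (real-valued). -/
def cauchyR (s : SignedM) (x : ℝ) : ℝ :=
  s.rintegral fun t => (x - t)⁻¹

/-- The total variation `|s|` (for the constant-sign representation used here). -/
def mass (s : SignedM) : ℝ :=
  (s.pos Set.univ).toReal + (s.neg Set.univ).toReal

/-- The (topological) support of a nonnegative measure. -/
def msupport (μ : MeasureTheory.Measure ℝ) : Set ℝ :=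
  {x | ∀ U : Set ℝ, IsOpen U → x ∈ U → μ U ≠ 0}

/-- The support of a signed measure. -/
def supp (s : SignedM) : Set ℝ := msupport s.pos ∪ msupport s.neg

/-- The signed measure `g·s` with (real, possibly sign-changing) density `g` w.r.t. `s`. -/
def withDensityR (s : SignedM) (g : ℝ → ℝ) : SignedM where
  pos := s.pos.withDensity (fun x => ENNReal.ofReal (g x)) +
    s.neg.withDensity (fun x => ENNReal.ofReal (-g x))
  neg := s.pos.withDensity (fun x => ENNReal.ofReal (-g x)) +
    s.neg.withDensity (fun x => ENNReal.ofReal (g x))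

/-- The product `⟨a, b⟩`: the measure with density `b̂` with respect to `a`. -/
def nik (a b : SignedM) : SignedM := a.withDensityR b.cauchyR

end SignedM

/-- `s ∈ M(Δ)`: a finite Borel measure with constant sign, whose support is compact and
consists of infinitely many points, `Δ` being the smallest closed interval containing it. -/
structure IsM (s : SignedM) (Δ : Set ℝ) : Prop where
  posFinite : MeasureTheory.IsFiniteMeasure s.pos
  negFinite : MeasureTheory.IsFiniteMeasure s.neg
  constSign : s.pos = 0 ∨ s.neg = 0
  compactSupp : IsCompact s.supp
  infiniteSupp : s.supp.Infinite
  hullEq : Δ = Set.Icc (sInf s.supp) (sSup s.supp)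

/-- A set of reals, viewed inside `ℂ`. -/
def cSet (Δ : Set ℝ) : Set ℂ := (fun x : ℝ => (x : ℂ)) '' Δ

/-- `τ` is the inverse measure of `s`: `1/ŝ(z) = z/|s| + b + τ̂(z)` on `ℂ ∖ Δ`. -/
def IsInverse (s τ : SignedM) (Δ : Set ℝ) : Prop :=
  ∃ b : ℝ, ∀ z : ℂ, z ∉ cSet Δ →
    (s.cauchy z)⁻¹ = z / (s.mass : ℂ) + (b : ℂ) + τ.cauchy z

/-- The iterated products `s_{j,k} = ⟨σ_j, σ_{j+1}, …, σ_k⟩` of a Nikishin system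
(`s_{j,k} = σ_j` when `j ≥ k`). -/
def nikSys (σ : ℕ → SignedM) : ℕ → ℕ → SignedM
  | j, k => if h : j < k then (σ j).nik (nikSys σ (j + 1) k) else σ j
  termination_by j k => k - j
  decreasing_by omega

open Topology Bornology

lemma isCompact_cSet {K : Set ℝ} (hK : IsCompact K) : IsCompact (cSet K) :=
  hK.image Complex.continuous_ofReal

lemma SignedM.msupport_eq_support (μ : Measure ℝ) : SignedM.msupport μ = μ.support := by
  rw [Measure.support_eq_forall_isOpen]
  ext x
  simp only [SignedM.msupport, Set.mem_ofPred_eq, pos_iff_ne_zero]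
  exact ⟨fun h U hx hU => h U hU hx, fun h U hU hx => h U hx hU⟩

lemma SignedM.ae_mem_Icc (s : SignedM) (hs : IsCompact s.supp) :
    (∀ᵐ x ∂s.pos, x ∈ Icc (sInf s.supp) (sSup s.supp)) ∧
      ∀ᵐ x ∂s.neg, x ∈ Icc (sInf s.supp) (sSup s.supp) := by
  have hsub : s.supp ⊆ Icc (sInf s.supp) (sSup s.supp) :=
    subset_Icc_csInf_csSup hs.bddBelow hs.bddAbove
  refine ⟨?_, ?_⟩
  · filter_upwards [Measure.support_mem_ae (μ := s.pos)] with x hx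
    exact hsub (Or.inl ((SignedM.msupport_eq_support s.pos).symm ▸ hx))
  · filter_upwards [Measure.support_mem_ae (μ := s.neg)] with x hx
    exact hsub (Or.inr ((SignedM.msupport_eq_support s.neg).symm ▸ hx))

lemma integrable_of_continuousOn_of_ae_mem {K : Set ℝ} (hK : IsCompact K) {μ : Measure ℝ}
    [IsFiniteMeasure μ] (hμ : ∀ᵐ x ∂μ, x ∈ K) {g : ℝ → ℂ} (hg : ContinuousOn g K) :
    Integrable g μ := by
  have h := hg.integrableOn_compact (μ := μ) hK
  rwa [IntegrableOn, Measure.restrict_eq_self_of_ae_mem hμ] at h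

/-- An integral over a compact set of a jointly continuous family of holomorphic functions is
holomorphic in the parameter. -/
lemma differentiableOn_integral_of_continuousOn {K : Set ℝ} (hK : IsCompact K) {μ : Measure ℝ}
    [IsFiniteMeasure μ] (hμ : ∀ᵐ x ∂μ, x ∈ K) {U : Set ℂ} (hU : IsOpen U) {φ : ℝ → ℂ → ℂ}
    (hcont : ContinuousOn (Function.uncurry φ) (K ×ˢ U))
    (hdiff : ∀ x ∈ K, DifferentiableOn ℂ (φ x) U) :
    DifferentiableOn ℂ (fun z => ∫ x, φ x z ∂μ) U := by
  intro z₀ hz₀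
  have hcx : ∀ z ∈ U, ContinuousOn (fun x => φ x z) K := fun z hz =>
    hcont.comp (f := fun x : ℝ => (x, z)) (by fun_prop) fun x hx => ⟨hx, hz⟩
  have hint : ∀ z ∈ U, Integrable (fun x => φ x z) μ := fun z hz =>
    integrable_of_continuousOn_of_ae_mem hK hμ (hcx z hz)
  obtain ⟨r, hr, hrU⟩ := Metric.nhds_basis_closedBall.mem_iff.1 (hU.mem_nhds hz₀)
  obtain ⟨C, hC⟩ := (hK.prod (isCompact_closedBall z₀ r)).exists_bound_of_continuousOn
    (hcont.mono (Set.prod_mono_right hrU))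
  have hr2 : 0 < r / 2 := half_pos hr
  have hsub : ∀ z ∈ Metric.ball z₀ (r / 2), Metric.closedBall z (r / 2) ⊆ Metric.closedBall z₀ r :=
    fun z hz => Metric.closedBall_subset_closedBall' (by
      have := Metric.mem_ball.1 hz
      linarith)
  have hder : ∀ x ∈ K, ∀ z ∈ U, HasDerivAt (φ x) (deriv (φ x) z) z := fun x hx z hz =>
    ((hdiff x hx).differentiableAt (hU.mem_nhds hz)).hasDerivAt
  have hmeas : AEStronglyMeasurable (fun x => deriv (φ x) z₀) μ := by
    classical
    refine aestronglyMeasurable_of_tendsto_ae (𝓝[≠] z₀)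
      (f := fun z x => if z ∈ U then slope (φ x) z₀ z else 0) (fun z => ?_) ?_
    · by_cases hz : z ∈ U
      · simp only [hz, if_true, slope_def_field]
        exact (((hint z hz).sub (hint z₀ hz₀)).div_const _).aestronglyMeasurable
      · simp only [hz, if_false]
        exact aestronglyMeasurable_const
    · filter_upwards [hμ] with x hx
      refine (hasDerivAt_iff_tendsto_slope.1 (hder x hx z₀ hz₀)).congr' ?_
      filter_upwards [mem_nhdsWithin_of_mem_nhds (hU.mem_nhds hz₀)] with z hz
      simp [hz]
  refine (hasDerivAt_integral_of_dominated_loc_of_deriv_le (F := fun z x => φ x z)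
    (F' := fun z x => deriv (φ x) z) (bound := fun _ => C / (r / 2))
    (Metric.ball_mem_nhds z₀ hr2) ?_ (hint z₀ hz₀) hmeas ?_ (integrable_const _)
    ?_).2.differentiableAt.differentiableWithinAt
  · filter_upwards [hU.mem_nhds hz₀] with z hz using (hint z hz).aestronglyMeasurable
  · filter_upwards [hμ] with x hx z hz
    refine Complex.norm_deriv_le_of_forall_mem_sphere_norm_le hr2 ?_ fun w hw =>
      hC (x, w) ⟨hx, hsub z hz (Metric.sphere_subset_closedBall hw)⟩
    refine DifferentiableOn.diffContOnCl ((hdiff x hx).mono ?_)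
    rw [closure_ball z hr2.ne']
    exact (hsub z hz).trans hrU
  · filter_upwards [hμ] with x hx z hz
    exact hder x hx z (hrU (Metric.ball_subset_closedBall (Metric.ball_subset_ball (by linarith) hz)))

/-- The divided difference of a holomorphic function is jointly continuous. -/
lemma continuousOn_uncurry_dslope {V : Set ℂ} (hV : IsOpen V) {f : ℂ → ℂ}
    (hf : DifferentiableOn ℂ f V) :
    ContinuousOn (fun p : ℂ × ℂ => dslope f p.1 p.2) (V ×ˢ V) := by
  rintro ⟨x, z⟩ ⟨hx, hz⟩
  refine ContinuousAt.continuousWithinAt ?_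
  have hfc : ∀ w ∈ V, ContinuousAt f w := fun w hw =>
    (hf.differentiableAt (hV.mem_nhds hw)).continuousAt
  simp only at hx hz
  by_cases hxz : z = x
  · subst hxz
    have han : AnalyticAt ℂ f z := hf.analyticAt (hV.mem_nhds hz)
    have hstrict := han.hasStrictDerivAt
    have hderiv : ContinuousAt (deriv f) z := han.deriv.continuousAt
    rw [Metric.continuousAt_iff']
    intro ε hε
    have h1 := (hasStrictDerivAt_iff_hasStrictFDerivAt.1 hstrict).isLittleO.def (half_pos hε)
    have h2 : ∀ᶠ p : ℂ × ℂ in 𝓝 (z, z), dist (deriv f p.1) (deriv f z) < ε :=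
      (hderiv.comp (f := Prod.fst) (x := (z, z)) continuousAt_fst).eventually
        (Metric.ball_mem_nhds _ hε)
    filter_upwards [h1, h2] with p hp1 hp2
    simp only [dslope_same]
    by_cases hp : p.2 = p.1
    · rw [hp, dslope_same]
      exact hp2
    · rw [dslope_of_ne _ hp, slope_comm, slope_def_field, dist_eq_norm]
      have hne : p.1 - p.2 ≠ 0 := sub_ne_zero.2 (Ne.symm hp)
      have hpos := norm_pos_iff.2 hne
      have : (f p.1 - f p.2) / (p.1 - p.2) - deriv f z =
          (f p.1 - f p.2 - (p.1 - p.2) * deriv f z) / (p.1 - p.2) := by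
        field_simp
      rw [this, norm_div, div_lt_iff₀ hpos]
      have hp1' : ‖f p.1 - f p.2 - (p.1 - p.2) * deriv f z‖ ≤ ε / 2 * ‖p.1 - p.2‖ := by
        simpa using hp1
      nlinarith
  · have hev : ∀ᶠ p : ℂ × ℂ in 𝓝 (x, z), (f p.2 - f p.1) / (p.2 - p.1) = dslope f p.1 p.2 := by
      have : ∀ᶠ p : ℂ × ℂ in 𝓝 (x, z), p.2 ≠ p.1 :=
        (isOpen_ne_fun continuous_snd continuous_fst).mem_nhds hxz
      filter_upwards [this] with p hp
      rw [dslope_of_ne _ hp, slope_def_field]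
    refine ContinuousAt.congr ?_ hev
    exact (((hfc z hz).comp (f := Prod.snd) (x := (x, z)) continuousAt_snd).sub
      ((hfc x hx).comp (f := Prod.fst) (x := (x, z)) continuousAt_fst)).div
      (continuousAt_snd.sub continuousAt_fst) (sub_ne_zero.2 hxz)

section CauchyKernel

variable {K : Set ℝ} {V : Set ℂ} {f : ℂ → ℂ}

lemma sub_ofReal_ne_zero_of_notMem_cSet {x : ℝ} (hx : x ∈ K) {z : ℂ} (hz : z ∉ cSet K) :
    z - x ≠ 0 := fun h => hz ⟨x, hx, (sub_eq_zero.1 h).symm⟩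

lemma continuousOn_comp_ofReal (hKV : cSet K ⊆ V) (hf : ContinuousOn f V) :
    ContinuousOn (fun x : ℝ => f x) K :=
  hf.comp Complex.continuous_ofReal.continuousOn fun x hx => hKV ⟨x, hx, rfl⟩

variable {μ : Measure ℝ} [IsFiniteMeasure μ]

lemma differentiableOn_integral_dslope (hK : IsCompact K) (hμ : ∀ᵐ x ∂μ, x ∈ K) (hV : IsOpen V)
    (hKV : cSet K ⊆ V) (hf : DifferentiableOn ℂ f V) :
    DifferentiableOn ℂ (fun z => ∫ x : ℝ, dslope f x z ∂μ) V := by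
  refine differentiableOn_integral_of_continuousOn hK hμ hV (φ := fun x z => dslope f x z) ?_ ?_
  · exact (continuousOn_uncurry_dslope hV hf).comp
      (f := fun p : ℝ × ℂ => ((p.1 : ℂ), p.2)) (by fun_prop)
      fun p hp => ⟨hKV ⟨p.1, hp.1, rfl⟩, hp.2⟩
  · exact fun x hx =>
      (Complex.differentiableOn_dslope (hV.mem_nhds (hKV ⟨x, hx, rfl⟩))).2 hf

lemma differentiableOn_integral_mul_inv (hK : IsCompact K) (hμ : ∀ᵐ x ∂μ, x ∈ K)
    (hKV : cSet K ⊆ V) (hf : DifferentiableOn ℂ f V) :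
    DifferentiableOn ℂ (fun z : ℂ => ∫ x : ℝ, f x * (z - x)⁻¹ ∂μ) (cSet K)ᶜ := by
  refine differentiableOn_integral_of_continuousOn hK hμ (isCompact_cSet hK).isClosed.isOpen_compl
    (φ := fun x z => f x * (z - x)⁻¹) ?_ ?_
  · refine ContinuousOn.mul ?_ ?_
    · exact (continuousOn_comp_ofReal hKV hf.continuousOn).comp continuousOn_fst fun p hp => hp.1
    · exact ContinuousOn.inv₀ (by fun_prop) fun p hp =>
        sub_ofReal_ne_zero_of_notMem_cSet hp.1 hp.2
  · intro x hx z hz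
    have := sub_ofReal_ne_zero_of_notMem_cSet hx hz
    fun_prop (disch := assumption)

lemma mul_integral_inv_eq (hK : IsCompact K) (hμ : ∀ᵐ x ∂μ, x ∈ K) (hKV : cSet K ⊆ V)
    (hf : ContinuousOn f V) {z : ℂ} (hz : z ∉ cSet K) :
    f z * ∫ x : ℝ, (z - x)⁻¹ ∂μ =
      ∫ x : ℝ, f x * (z - x)⁻¹ ∂μ + ∫ x : ℝ, dslope f x z ∂μ := by
  have hinv : ContinuousOn (fun x : ℝ => (z - (x : ℂ))⁻¹) K :=
    ContinuousOn.inv₀ (by fun_prop) fun x hx => sub_ofReal_ne_zero_of_notMem_cSet hx hz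
  have hi := integrable_of_continuousOn_of_ae_mem hK hμ hinv
  have hfi : Integrable (fun x : ℝ => f x * (z - x)⁻¹) μ :=
    integrable_of_continuousOn_of_ae_mem hK hμ ((continuousOn_comp_ofReal hKV hf).mul hinv)
  rw [← integral_const_mul, ← sub_eq_iff_eq_add',
    ← integral_sub (hi.const_mul (f z)) hfi]
  refine integral_congr_ae ?_
  filter_upwards [hμ] with x hx
  have hne := sub_ofReal_ne_zero_of_notMem_cSet hx hz
  rw [dslope_of_ne _ (sub_ne_zero.1 hne), slope_def_field]
  field_simp

lemma tendsto_mul_integral_mul_inv (hK : IsCompact K) (hμ : ∀ᵐ x ∂μ, x ∈ K) (hKV : cSet K ⊆ V)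
    (hf : ContinuousOn f V) :
    Tendsto (fun z : ℂ => z * ∫ x : ℝ, f x * (z - x)⁻¹ ∂μ) (cobounded ℂ)
      (𝓝 (∫ x : ℝ, f x ∂μ)) := by
  have hcf := continuousOn_comp_ofReal hKV hf
  obtain ⟨M, hM⟩ := hK.exists_bound_of_continuousOn Complex.continuous_ofReal.continuousOn
  have : (cobounded ℂ).IsCountablyGenerated := by
    rw [← comap_norm_atTop]
    infer_instance
  simp_rw [← integral_const_mul]
  refine tendsto_integral_filter_of_dominated_convergence (fun x : ℝ => ‖f x‖ * 2) ?_ ?_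
    ((integrable_of_continuousOn_of_ae_mem hK hμ hcf).norm.mul_const 2) ?_
  · filter_upwards [(isCompact_cSet hK).isBounded] with z hz
    have hinv : ContinuousOn (fun x : ℝ => (z - (x : ℂ))⁻¹) K :=
      ContinuousOn.inv₀ (by fun_prop) fun x hx => sub_ofReal_ne_zero_of_notMem_cSet hx hz
    exact ((integrable_of_continuousOn_of_ae_mem hK hμ
      (hcf.mul hinv)).const_mul z).aestronglyMeasurable
  · have h : ∀ᶠ z : ℂ in cobounded ℂ, max 1 (2 * M) ≤ ‖z‖ :=
      tendsto_norm_cobounded_atTop.eventually_ge_atTop _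
    filter_upwards [h] with z hz
    filter_upwards [hμ] with x hx
    have h1 : 1 ≤ ‖z‖ := (le_max_left _ _).trans hz
    have h2 : 2 * M ≤ ‖z‖ := (le_max_right _ _).trans hz
    have h3 : ‖z‖ / 2 ≤ ‖z - x‖ := by
      have := norm_sub_norm_le z (x : ℂ)
      have := hM x hx
      linarith
    have h4 : ‖z‖ * ‖z - x‖⁻¹ ≤ 2 := by
      rw [← div_eq_mul_inv, div_le_iff₀ (by linarith)]
      linarith
    rw [norm_mul, norm_mul, norm_inv]
    calc ‖z‖ * (‖f x‖ * ‖z - x‖⁻¹) = ‖f x‖ * (‖z‖ * ‖z - x‖⁻¹) := by ring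
      _ ≤ ‖f x‖ * 2 := by gcongr
  · refine Eventually.of_forall fun x => ?_
    have h0 : Tendsto (fun z : ℂ => 1 - x * z⁻¹) (cobounded ℂ) (𝓝 (1 - x * 0)) :=
      (tendsto_inv₀_cobounded.const_mul _).const_sub _
    have h1 : Tendsto (fun z : ℂ => f x * (1 - x * z⁻¹)⁻¹) (cobounded ℂ)
        (𝓝 (f x * (1 - (x : ℂ) * 0)⁻¹)) := (h0.inv₀ (by simp)).const_mul _
    rw [mul_zero, sub_zero, inv_one, mul_one] at h1
    refine h1.congr' ?_
    filter_upwards [eventually_ne_cobounded (0 : ℂ)] with z hz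
    have : 1 - x * z⁻¹ = (z - x) * z⁻¹ := by field_simp
    rw [this, mul_inv, inv_inv]
    ring

end CauchyKernel

/-- If `F` is holomorphic on `ℂ ∖ Δ`, agrees near `Δ` with
`f₀ + Σ_{k=1}^m f_k·ŝ_k` and is `O(1/z²)` at infinity, then `Σ_k ∫ f_k ds_k = 0`. -/
theorem stmt0
    (m : ℕ) (hm : 1 ≤ m)
    (s : ℕ → SignedM) (Δ : Set ℝ)
    (hfin : ∀ k, 1 ≤ k → k ≤ m →
      MeasureTheory.IsFiniteMeasure (s k).pos ∧ MeasureTheory.IsFiniteMeasure (s k).neg)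
    (hsupp : ∀ k, 1 ≤ k → k ≤ m → IsCompact (s k).supp ∧ (s k).supp.Nonempty ∧
      Δ = Set.Icc (sInf (s k).supp) (sSup (s k).supp))
    (V : Set ℂ) (hV : IsOpen V) (hΔV : cSet Δ ⊆ V)
    (f : ℕ → ℂ → ℂ) (hf : ∀ k ≤ m, DifferentiableOn ℂ (f k) V)
    (F : ℂ → ℂ) (hF : DifferentiableOn ℂ F (cSet Δ)ᶜ)
    (hagree : ∀ z ∈ V \ cSet Δ,
      F z = f 0 z + ∑ k ∈ Finset.Icc 1 m, f k z * (s k).cauchy z)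
    (hO : ∃ C R : ℝ, ∀ z : ℂ, R ≤ ‖z‖ → ‖z ^ 2 * F z‖ ≤ C) :
    ∑ k ∈ Finset.Icc 1 m, (s k).cintegral (fun x => f k (x : ℂ)) = 0 := by
  obtain ⟨-, -, hΔ1⟩ := hsupp 1 le_rfl hm
  have hΔ : IsCompact Δ := hΔ1 ▸ isCompact_Icc
  have hfk : ∀ k ∈ Finset.Icc 1 m, DifferentiableOn ℂ (f k) V := fun k hk =>
    hf k (Finset.mem_Icc.1 hk).2
  have hfinp : ∀ k ∈ Finset.Icc 1 m, IsFiniteMeasure (s k).pos := fun k hk =>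
    (hfin k (Finset.mem_Icc.1 hk).1 (Finset.mem_Icc.1 hk).2).1
  have hfinn : ∀ k ∈ Finset.Icc 1 m, IsFiniteMeasure (s k).neg := fun k hk =>
    (hfin k (Finset.mem_Icc.1 hk).1 (Finset.mem_Icc.1 hk).2).2
  have hae : ∀ k ∈ Finset.Icc 1 m, (∀ᵐ x ∂(s k).pos, x ∈ Δ) ∧ ∀ᵐ x ∂(s k).neg, x ∈ Δ := by
    intro k hk
    obtain ⟨hc, -, h⟩ := hsupp k (Finset.mem_Icc.1 hk).1 (Finset.mem_Icc.1 hk).2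
    rw [h]
    exact (s k).ae_mem_Icc hc
  set G : ℂ → ℂ := fun z => ∑ k ∈ Finset.Icc 1 m, (s k).cintegral fun x => f k x * (z - x)⁻¹
    with hG_def
  set H : ℂ → ℂ := fun z =>
    f 0 z + ∑ k ∈ Finset.Icc 1 m, (s k).cintegral fun x => dslope (f k) x z with hH_def
  have hG : DifferentiableOn ℂ G (cSet Δ)ᶜ := by
    refine DifferentiableOn.fun_sum fun k hk => ?_
    have := hfinp k hk
    have := hfinn k hk
    exact (differentiableOn_integral_mul_inv hΔ (hae k hk).1 hΔV (hfk k hk)).sub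
      (differentiableOn_integral_mul_inv hΔ (hae k hk).2 hΔV (hfk k hk))
  have hH : DifferentiableOn ℂ H V := by
    refine (hf 0 (Nat.zero_le m)).add (DifferentiableOn.fun_sum fun k hk => ?_)
    have := hfinp k hk
    have := hfinn k hk
    exact (differentiableOn_integral_dslope hΔ (hae k hk).1 hV hΔV (hfk k hk)).sub
      (differentiableOn_integral_dslope hΔ (hae k hk).2 hV hΔV (hfk k hk))
  have hFGH : ∀ z ∈ V \ cSet Δ, F z - G z = H z := by
    intro z hz
    rw [hagree z hz, sub_eq_iff_eq_add', hG_def, hH_def]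
    simp only
    rw [add_left_comm, ← Finset.sum_add_distrib]
    congr 1
    refine Finset.sum_congr rfl fun k hk => ?_
    have := hfinp k hk
    have := hfinn k hk
    simp only [SignedM.cauchy, SignedM.cintegral]
    rw [mul_sub, mul_integral_inv_eq hΔ (hae k hk).1 hΔV (hfk k hk).continuousOn hz.2,
      mul_integral_inv_eq hΔ (hae k hk).2 hΔV (hfk k hk).continuousOn hz.2]
    ring
  have hzG : Tendsto (fun z => z * G z) (cobounded ℂ)
      (𝓝 (∑ k ∈ Finset.Icc 1 m, (s k).cintegral fun x => f k x)) := by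
    simp_rw [hG_def, Finset.mul_sum]
    refine tendsto_finsetSum _ fun k hk => ?_
    have := hfinp k hk
    have := hfinn k hk
    simp only [SignedM.cintegral, mul_sub]
    exact (tendsto_mul_integral_mul_inv hΔ (hae k hk).1 hΔV (hfk k hk).continuousOn).sub
      (tendsto_mul_integral_mul_inv hΔ (hae k hk).2 hΔV (hfk k hk).continuousOn)
  have hzF : Tendsto (fun z => z * F z) (cobounded ℂ) (𝓝 0) := by
    obtain ⟨C, R, hCR⟩ := hO
    have h0 : Tendsto (fun z : ℂ => C * ‖z⁻¹‖) (cobounded ℂ) (𝓝 0) := by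
      simpa using (tendsto_inv₀_cobounded (α := ℂ)).norm.const_mul C
    refine squeeze_zero_norm' ?_ h0
    filter_upwards [tendsto_norm_cobounded_atTop.eventually_ge_atTop R,
      eventually_ne_cobounded (0 : ℂ)] with z hz hz0
    have : z * F z = z ^ 2 * F z * z⁻¹ := by field_simp
    rw [this, norm_mul]
    gcongr
    exact hCR z hz
  have hdecay : ∀ {g : ℂ → ℂ} {a : ℂ}, Tendsto (fun z => z * g z) (cobounded ℂ) (𝓝 a) →
      Tendsto g (cobounded ℂ) (𝓝 0) := by
    intro g a h
    have h1 := (tendsto_inv₀_cobounded (α := ℂ)).mul h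
    rw [zero_mul] at h1
    refine h1.congr' ?_
    filter_upwards [eventually_ne_cobounded (0 : ℂ)] with z hz
    field_simp
  have hoff : ∀ᶠ z in cobounded ℂ, z ∉ cSet Δ := (isCompact_cSet hΔ).isBounded
  classical
  set E : ℂ → ℂ := fun z => if z ∈ cSet Δ then H z else F z - G z with hE_def
  have hE_out : ∀ z ∉ cSet Δ, E z = F z - G z := fun z hz => if_neg hz
  have hE_in : ∀ z ∈ V, E z = H z := by
    intro z hz
    by_cases hzΔ : z ∈ cSet Δ
    · exact if_pos hzΔ
    · rw [hE_out z hzΔ, hFGH z ⟨hz, hzΔ⟩]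
  have hE : Differentiable ℂ E := by
    intro z
    by_cases hz : z ∈ cSet Δ
    · have hVz := hV.mem_nhds (hΔV hz)
      exact (hH.differentiableAt hVz).congr_of_eventuallyEq (eventually_of_mem hVz hE_in)
    · have hz' := (isCompact_cSet hΔ).isClosed.isOpen_compl.mem_nhds hz
      exact ((hF.sub hG).differentiableAt hz').congr_of_eventuallyEq
        (eventually_of_mem hz' hE_out)
  have hE_lim : Tendsto E (cocompact ℂ) (𝓝 0) := by
    rw [← Metric.cobounded_eq_cocompact]
    have h := (hdecay hzF).sub (hdecay hzG)
    rw [sub_zero] at h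
    exact h.congr' (hoff.mono fun z hz => (hE_out z hz).symm)
  have hFG : ∀ᶠ z in cobounded ℂ, z * F z = z * G z := by
    filter_upwards [hoff] with z hz
    rw [sub_eq_zero.1 ((hE_out z hz).symm.trans (hE.apply_eq_of_tendsto_cocompact z hE_lim))]
  exact tendsto_nhds_unique hzG (hzF.congr' hFG)
end
end

section
/- Let (s_{1,1}, …, s_{1,m}) = N(σ_1, …, σ_m) be a Nikishin system with m ≥ 1, let n = (n_0, …, n_m) ∈ ℤ₊^{m+1}, and let p_0, …, p_m be real polynomials with deg p_k ≤ n_k − 1 (p_k ≡ 0 if n_k = 0). Set L = p_0 + Σ_{k=1}^m p_k·ŝ_{1,k}, a holomorphic function on ℂ ∖ Δ_1. Assume n_0 = max{n_0, n_1 − 1, …, n_m − 1}. If L has at least |n| zeros in ℂ ∖ Δ_1 counting multiplicities, then the reduced form p_1 + Σ_{k=2}^m p_k·ŝ_{2,k} (a holomorphic function on ℂ ∖ Δ_2) either vanishes identically or has at least |n| − n_0 sign changes in the interior of Δ_1; in particular it then has at least |n| − n_0 zeros in ℂ ∖ Δ_2. -/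
open MeasureTheory Set Polynomial Filter

noncomputable section

section CauchyIntegral

variable {μ : Measure ℝ} [IsFiniteMeasure μ] {K : Set ℝ}

lemma ae_mem_of_null_compl {μ : Measure ℝ} {K : Set ℝ} (hμ : μ Kᶜ = 0) : ∀ᵐ x ∂μ, x ∈ K := by
  rw [ae_iff]
  exact hμ

lemma integrable_of_continuousOn {E : Type*} [NormedAddCommGroup E] (hK : IsCompact K)
    (hμ : μ Kᶜ = 0) {f : ℝ → E} (hf : ContinuousOn f K) : Integrable f μ := by
  have h := hf.integrableOn_compact (μ := μ) hK
  rwa [IntegrableOn, Measure.restrict_eq_self_of_ae_mem (ae_mem_of_null_compl hμ)] at h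

lemma sub_ofReal_ne_zero {z : ℂ} (hz : z ∉ cSet K) {x : ℝ} (hx : x ∈ K) : z - (x : ℂ) ≠ 0 :=
  fun h => hz ⟨x, hx, (sub_eq_zero.1 h).symm⟩

lemma ofReal_mem_cSet {x : ℝ} : (x : ℂ) ∈ cSet K ↔ x ∈ K := by
  simp [cSet]

lemma isClosed_cSet (hK : IsCompact K) : IsClosed (cSet K) :=
  (hK.image Complex.continuous_ofReal).isClosed

lemma continuousOn_mul_inv_sub {z : ℂ} (hz : z ∉ cSet K) {w : ℝ → ℂ} (hw : ContinuousOn w K) :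
    ContinuousOn (fun x : ℝ => w x * (z - x)⁻¹) K :=
  hw.mul (ContinuousOn.inv₀ (by fun_prop) fun _ hx => sub_ofReal_ne_zero hz hx)

lemma integrable_mul_inv_sub (hK : IsCompact K) (hμ : μ Kᶜ = 0) {z : ℂ} (hz : z ∉ cSet K)
    {w : ℝ → ℂ} (hw : ContinuousOn w K) : Integrable (fun x : ℝ => w x * (z - x)⁻¹) μ :=
  integrable_of_continuousOn hK hμ (continuousOn_mul_inv_sub hz hw)

lemma differentiableAt_integral_mul_inv_sub (hK : IsCompact K) (hμ : μ Kᶜ = 0) {z : ℂ}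
    (hz : z ∉ cSet K) {w : ℝ → ℂ} (hw : ContinuousOn w K) :
    DifferentiableAt ℂ (fun z : ℂ => ∫ x, w x * (z - (x : ℂ))⁻¹ ∂μ) z := by
  have hopen : (cSet K)ᶜ ∈ nhds z := (isClosed_cSet hK).isOpen_compl.mem_nhds hz
  obtain ⟨r, hr, hball⟩ := Metric.mem_nhds_iff.1 hopen
  have hlow : ∀ x ∈ K, ∀ y ∈ Metric.ball z (r / 2), r / 2 ≤ ‖y - (x : ℂ)‖ := by
    intro x hx y hy
    have h1 : r ≤ dist (x : ℂ) z := by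
      by_contra! h
      exact hball (Metric.mem_ball.2 h) (ofReal_mem_cSet.2 hx)
    have h2 := dist_triangle_right (x : ℂ) z y
    rw [Metric.mem_ball, dist_comm] at hy
    rw [← dist_eq_norm, dist_comm]
    linarith
  refine (hasDerivAt_integral_of_dominated_loc_of_deriv_le
    (F := fun z (x : ℝ) => w x * (z - (x : ℂ))⁻¹)
    (F' := fun y (x : ℝ) => w x * (-1 / (y - (x : ℂ)) ^ 2))
    (bound := fun x => ‖w x‖ * (1 / (r / 2) ^ 2))
    (Metric.ball_mem_nhds z (half_pos hr)) ?_ ?_ ?_ ?_ ?_ ?_).2.differentiableAt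
  · filter_upwards [hopen] with y hy
    exact (integrable_mul_inv_sub hK hμ hy hw).aestronglyMeasurable
  · exact integrable_mul_inv_sub hK hμ hz hw
  · refine (integrable_of_continuousOn hK hμ (hw.mul ?_)).aestronglyMeasurable
    exact continuousOn_const.div (by fun_prop) fun x hx => pow_ne_zero _ (sub_ofReal_ne_zero hz hx)
  · filter_upwards [ae_mem_of_null_compl hμ] with x hx y hy
    rw [norm_mul, norm_div, norm_neg, norm_one, norm_pow]
    have := hlow x hx y hy
    gcongr
  · exact (integrable_of_continuousOn hK hμ hw).norm.mul_const _
  · filter_upwards [ae_mem_of_null_compl hμ] with x hx y hy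
    have hne : y - (x : ℂ) ≠ 0 := by
      rw [← norm_pos_iff]
      linarith [hlow x hx y hy]
    exact (((hasDerivAt_id y).sub_const (x : ℂ)).inv hne).const_mul (w x)

end CauchyIntegral

/-- Both parts of `s` are finite and concentrated on `K`. -/
structure SignedM.ConcentratedOn (s : SignedM) (K : Set ℝ) : Prop where
  posFinite : IsFiniteMeasure s.pos
  negFinite : IsFiniteMeasure s.neg
  pos_compl : s.pos Kᶜ = 0
  neg_compl : s.neg Kᶜ = 0

namespace SignedM.ConcentratedOn

variable {s : SignedM} {K : Set ℝ}

lemma differentiableAt_cauchy (hs : s.ConcentratedOn K) (hK : IsCompact K) {z : ℂ}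
    (hz : z ∉ cSet K) : DifferentiableAt ℂ s.cauchy z := by
  have := hs.posFinite
  have := hs.negFinite
  have h1 := differentiableAt_integral_mul_inv_sub hK hs.pos_compl hz
    (w := fun _ => 1) continuousOn_const
  have h2 := differentiableAt_integral_mul_inv_sub hK hs.neg_compl hz
    (w := fun _ => 1) continuousOn_const
  simp only [one_mul] at h1 h2
  exact h1.sub h2

lemma measurable_cauchyR (hs : s.ConcentratedOn K) : Measurable s.cauchyR := by
  have := hs.posFinite
  have := hs.negFinite
  have h : StronglyMeasurable (Function.uncurry fun x t : ℝ => (x - t)⁻¹) :=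
    (measurable_fst.sub measurable_snd).inv.stronglyMeasurable
  exact h.integral_prod_right.measurable.sub h.integral_prod_right.measurable

end SignedM.ConcentratedOn

namespace SignedM

lemma cauchy_ofReal (s : SignedM) (x : ℝ) : s.cauchy x = s.cauchyR x := by
  simp only [cauchy, cintegral, cauchyR, rintegral, Complex.ofReal_sub, ← integral_complex_ofReal,
    Complex.ofReal_inv]

lemma cauchy_conj (s : SignedM) (z : ℂ) :
    s.cauchy (starRingEnd ℂ z) = starRingEnd ℂ (s.cauchy z) := by
  simp only [cauchy, cintegral, map_sub, ← integral_conj, map_inv₀, Complex.conj_ofReal]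

end SignedM

namespace SignedM.ConcentratedOn

variable {s : SignedM} {K : Set ℝ}

lemma continuousOn_cauchyR (hs : s.ConcentratedOn K) (hK : IsCompact K) :
    ContinuousOn s.cauchyR Kᶜ := by
  have h : s.cauchyR = fun x : ℝ => (s.cauchy x).re := by
    ext x
    rw [s.cauchy_ofReal, Complex.ofReal_re]
  rw [h]
  intro x hx
  have hd := (hs.differentiableAt_cauchy hK (mt ofReal_mem_cSet.1 hx)).continuousAt
  exact (Complex.continuous_re.continuousAt.comp
    (hd.comp Complex.continuous_ofReal.continuousAt)).continuousWithinAt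

lemma withDensityR (hs : s.ConcentratedOn K) (hK : IsCompact K) {g : ℝ → ℝ}
    (hg : ContinuousOn g K) : (s.withDensityR g).ConcentratedOn K := by
  have := hs.posFinite
  have := hs.negFinite
  have h1 := integrable_of_continuousOn hK hs.pos_compl hg
  have h2 := integrable_of_continuousOn hK hs.neg_compl hg
  have i1 := isFiniteMeasure_withDensity_ofReal h1.2
  have i2 := isFiniteMeasure_withDensity_ofReal h2.2
  have i3 := isFiniteMeasure_withDensity_ofReal h1.neg.2
  have i4 := isFiniteMeasure_withDensity_ofReal h2.neg.2
  simp only [Pi.neg_apply] at i3 i4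
  have hp := fun f => withDensity_absolutelyContinuous s.pos f hs.pos_compl
  have hn := fun f => withDensity_absolutelyContinuous s.neg f hs.neg_compl
  refine ⟨?_, ?_, ?_, ?_⟩
  · dsimp only [SignedM.withDensityR]; infer_instance
  · dsimp only [SignedM.withDensityR]; infer_instance
  · simp [SignedM.withDensityR, hp, hn]
  · simp [SignedM.withDensityR, hp, hn]

end SignedM.ConcentratedOn

lemma integral_withDensity_ofReal {μ : Measure ℝ} {g : ℝ → ℝ} (hg : Measurable g) (f : ℝ → ℂ) :
    ∫ x, f x ∂μ.withDensity (fun x => ENNReal.ofReal (g x)) =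
      ∫ x, ((max (g x) 0 : ℝ) : ℂ) * f x ∂μ := by
  have h := integral_withDensity_eq_integral_smul (μ := μ) hg.real_toNNReal f
  simpa [ENNReal.ofReal, NNReal.smul_def] using h

lemma SignedM.ConcentratedOn.cintegral_withDensityR {s : SignedM} {K : Set ℝ}
    (hs : s.ConcentratedOn K) (hK : IsCompact K) {g : ℝ → ℝ} (hgm : Measurable g)
    (hg : ContinuousOn g K) {f : ℝ → ℂ} (hf : ContinuousOn f K) :
    (s.withDensityR g).cintegral f = s.cintegral fun x => g x * f x := by
  have hs' := hs.withDensityR hK hg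
  have hgm' : Measurable fun x => -g x := hgm.neg
  have := hs.posFinite
  have := hs.negFinite
  have := hs'.posFinite
  have := hs'.negFinite
  have hpos : Integrable f (s.withDensityR g).pos := integrable_of_continuousOn hK hs'.pos_compl hf
  have hneg : Integrable f (s.withDensityR g).neg := integrable_of_continuousOn hK hs'.neg_compl hf
  simp only [SignedM.withDensityR] at hpos hneg
  rw [integrable_add_measure] at hpos hneg
  have key : ∀ μ : Measure ℝ, IsFiniteMeasure μ → μ Kᶜ = 0 →
      (∫ x, ((max (g x) 0 : ℝ) : ℂ) * f x ∂μ) - ∫ x, ((max (-g x) 0 : ℝ) : ℂ) * f x ∂μ =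
        ∫ x, g x * f x ∂μ := by
    intro μ _ hμ
    rw [← integral_sub]
    · congr 1
      ext x
      rw [← sub_mul, ← Complex.ofReal_sub]
      congr 2
      rcases le_total (g x) 0 with h | h
      · simp [h]
      · simp [h]
    · refine integrable_of_continuousOn hK hμ (ContinuousOn.mul ?_ hf)
      exact Complex.continuous_ofReal.comp_continuousOn (hg.sup continuousOn_const)
    · refine integrable_of_continuousOn hK hμ (ContinuousOn.mul ?_ hf)
      exact Complex.continuous_ofReal.comp_continuousOn (hg.neg.sup continuousOn_const)
  simp only [SignedM.cintegral, SignedM.withDensityR]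
  rw [integral_add_measure hpos.1 hpos.2, integral_add_measure hneg.1 hneg.2,
    integral_withDensity_ofReal hgm, integral_withDensity_ofReal hgm,
    integral_withDensity_ofReal hgm', integral_withDensity_ofReal hgm',
    ← key s.pos hs.posFinite hs.pos_compl, ← key s.neg hs.negFinite hs.neg_compl]
  ring

section ZeroRemoval

variable {μ : Measure ℝ} [IsFiniteMeasure μ] {K : Set ℝ}

/-- Moving a polynomial factor under the Cauchy integral only costs a polynomial of smaller
degree. -/
lemma exists_eval_mul_integral (hK : IsCompact K) (hμ : μ Kᶜ = 0) {w : ℝ → ℂ}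
    (hw : ContinuousOn w K) (n : ℕ) (p : ℂ[X]) (hp : p.degree < (n : WithBot ℕ)) :
    ∃ Q : ℂ[X], Q.degree < ((n - 1 : ℕ) : WithBot ℕ) ∧ ∀ z ∉ cSet K,
      p.eval z * ∫ x, w x * (z - (x : ℂ))⁻¹ ∂μ =
        Q.eval z + ∫ x, p.eval (x : ℂ) * w x * (z - (x : ℂ))⁻¹ ∂μ := by
  induction n generalizing p with
  | zero =>
    have : p = 0 := by simpa using hp
    exact ⟨0, by simp, by simp [this]⟩
  | succ n ih =>
    rcases Nat.eq_zero_or_pos n with rfl | hn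
    · obtain ⟨c, rfl⟩ : ∃ c, p = C c :=
        ⟨_, eq_C_of_degree_le_zero (degree_le_iff_coeff_zero _ _ |>.2 fun k hk =>
          (degree_lt_iff_coeff_zero p 1).1 hp k (by exact_mod_cast hk))⟩
      refine ⟨0, by simp, fun z _ => ?_⟩
      simp [mul_assoc, integral_const_mul]
    · have hdeg : p.divX.degree < (n : WithBot ℕ) := by
        by_cases hp0 : p.divX = 0
        · rw [hp0, degree_zero]; exact WithBot.bot_lt_coe n
        · rw [degree_eq_natDegree hp0, natDegree_divX_eq_natDegree_tsub_one]
          have h0 : p ≠ 0 := by rintro rfl; simp at hp0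
          rw [degree_eq_natDegree h0] at hp
          have : p.natDegree < n + 1 := by exact_mod_cast hp
          exact_mod_cast (by omega : p.natDegree - 1 < n)
      obtain ⟨Q, hQ, hQe⟩ := ih _ hdeg
      refine ⟨X * Q + C (∫ x, p.divX.eval (x : ℂ) * w x ∂μ), ?_, fun z hz => ?_⟩
      · rw [Nat.add_sub_cancel]
        refine (degree_add_le _ _).trans_lt (max_lt ?_ ?_)
        · by_cases hQ0 : Q = 0
          · rw [hQ0, mul_zero, degree_zero]; exact WithBot.bot_lt_coe n
          · rw [degree_eq_natDegree hQ0] at hQ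
            have : Q.natDegree < n - 1 := by exact_mod_cast hQ
            rw [degree_eq_natDegree (mul_ne_zero X_ne_zero hQ0), natDegree_X_mul hQ0]
            exact_mod_cast (by omega : Q.natDegree + 1 < n)
        · exact degree_C_le.trans_lt (by exact_mod_cast hn)
      · have hcont : ContinuousOn (fun x : ℝ => p.divX.eval (x : ℂ) * w x) K :=
          ContinuousOn.mul (by fun_prop) hw
        have hi1 := integrable_mul_inv_sub hK hμ hz hw
        have hi2 := integrable_mul_inv_sub hK hμ hz hcont
        have hi3 := integrable_of_continuousOn hK hμ hcont
        have hi4 : Integrable (fun x : ℝ => z * (p.divX.eval (x : ℂ) * w x * (z - (x : ℂ))⁻¹) -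
            p.divX.eval (x : ℂ) * w x) μ := (hi2.const_mul z).sub hi3
        have hpe : ∀ y : ℂ, p.eval y = y * p.divX.eval y + p.coeff 0 := by
          intro y
          conv_lhs => rw [← X_mul_divX_add p]
          simp only [eval_add, eval_mul, eval_X, eval_C]
        have hint : ∫ x, p.eval (x : ℂ) * w x * (z - (x : ℂ))⁻¹ ∂μ =
            z * (∫ x, p.divX.eval (x : ℂ) * w x * (z - (x : ℂ))⁻¹ ∂μ)
              - (∫ x, p.divX.eval (x : ℂ) * w x ∂μ)
              + p.coeff 0 * ∫ x, w x * (z - (x : ℂ))⁻¹ ∂μ := by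
          rw [← integral_const_mul, ← integral_const_mul, ← integral_sub (hi2.const_mul z) hi3,
            ← integral_add hi4 (hi1.const_mul _)]
          refine integral_congr_ae ?_
          filter_upwards [ae_mem_of_null_compl hμ] with x hx
          have := sub_ofReal_ne_zero hz hx
          rw [hpe]
          field_simp
          ring
        rw [hint, hpe z]
        simp only [eval_add, eval_mul, eval_X, eval_C]
        linear_combination z * hQe z hz

lemma analyticOrderAt_prod_sub (T : Multiset ℂ) (a : ℂ) :
    AnalyticAt ℂ (fun z => (T.map fun b => z - b).prod) a ∧
      analyticOrderAt (fun z => (T.map fun b => z - b).prod) a = T.count a := by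
  classical
  induction T using Multiset.induction with
  | empty =>
    simp only [Multiset.map_zero, Multiset.prod_zero, Multiset.count_zero, Nat.cast_zero]
    exact ⟨analyticAt_const, analyticOrderAt_eq_zero.2 (Or.inr one_ne_zero)⟩
  | cons b T ih =>
    have hb : AnalyticAt ℂ (fun z => z - b) a := by fun_prop
    have he : (fun z => ((b ::ₘ T).map fun b => z - b).prod) =
        (fun z => z - b) * fun z => (T.map fun b => z - b).prod := by
      ext z
      simp
    rw [he]
    refine ⟨hb.mul ih.1, ?_⟩
    rw [analyticOrderAt_mul hb ih.1, ih.2, Multiset.count_cons]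
    by_cases h : a = b
    · subst h
      have : analyticOrderAt (fun z => z - a) a = 1 := analyticOrderAt_id_sub_const_self
      rw [this]
      simp [add_comm]
    · have : analyticOrderAt (fun z => z - b) a = 0 := analyticOrderAt_id_sub_const_of_ne h
      rw [this]
      simp [h]

lemma continuousOn_mul_prod_sub_inv {g : ℝ → ℂ} (hg : ContinuousOn g K) {T : Multiset ℂ}
    (hT : ∀ a ∈ T, a ∉ cSet K) :
    ContinuousOn (fun x : ℝ => g x * ((T.map fun b => (x : ℂ) - b).prod)⁻¹) K := by
  refine hg.mul (ContinuousOn.inv₀ ?_ ?_)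
  · have : Continuous fun z : ℂ => (T.map fun b => z - b).prod :=
      continuous_multiset_prod _ fun b _ => by fun_prop
    exact (this.comp Complex.continuous_ofReal).continuousOn
  · intro x hx h
    obtain ⟨b, hb, hb0⟩ := Multiset.mem_map.1 (Multiset.prod_eq_zero_iff.1 h)
    exact hT b hb ⟨x, hx, sub_eq_zero.1 hb0⟩

/-- Dividing `P + ĝμ` by the zeros in `T`: the quotient has the same shape, and the new density is
orthogonal to the polynomials of degree less than `card T - n`. -/
lemma exists_quotient_by_zeros (hK : IsCompact K) (hμ : μ Kᶜ = 0) {g : ℝ → ℂ}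
    (hg : ContinuousOn g K) {n : ℕ} {P : ℂ[X]} (hP : P.degree < (n : WithBot ℕ)) {L : ℂ → ℂ}
    (hL : ∀ z ∉ cSet K, L z = P.eval z + ∫ x, g x * (z - (x : ℂ))⁻¹ ∂μ) (T : Multiset ℂ)
    (hT : ∀ a ∈ T, a ∉ cSet K) (hord : ∀ a, (T.count a : ℕ∞) ≤ analyticOrderAt L a) :
    ∃ Q : ℂ[X], Q.degree < ((n - T.card : ℕ) : WithBot ℕ) ∧
      (∀ z ∉ cSet K, L z = (T.map fun b => z - b).prod * (Q.eval z +
        ∫ x, g x * ((T.map fun b => (x : ℂ) - b).prod)⁻¹ * (z - (x : ℂ))⁻¹ ∂μ)) ∧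
      ∀ q : ℂ[X], q.degree < ((T.card - n : ℕ) : WithBot ℕ) →
        ∫ x, q.eval (x : ℂ) * (g x * ((T.map fun b => (x : ℂ) - b).prod)⁻¹) ∂μ = 0 := by
  classical
  induction T using Multiset.induction with
  | empty =>
    refine ⟨P, by simpa using hP, by simpa using hL, fun q hq => ?_⟩
    have : q = 0 := by simpa using hq
    simp [this]
  | cons a T ih =>
    have hT' : ∀ b ∈ T, b ∉ cSet K := fun b hb => hT b (Multiset.mem_cons_of_mem hb)
    have ha : a ∉ cSet K := hT a (Multiset.mem_cons_self a T)
    obtain ⟨Q, hQ, hLQ, horth⟩ := ih hT' fun b =>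
      le_trans (by exact_mod_cast Multiset.count_le_count_cons b a T) (hord b)
    set w : ℝ → ℂ := fun x => g x * ((T.map fun b => (x : ℂ) - b).prod)⁻¹ with hwdef
    have hw : ContinuousOn w K := continuousOn_mul_prod_sub_inv hg hT'
    have hw' : ∀ x : ℝ, g x * (((a ::ₘ T).map fun b => (x : ℂ) - b).prod)⁻¹ =
        -(w x * (a - (x : ℂ))⁻¹) := by
      intro x
      rw [hwdef, Multiset.map_cons, Multiset.prod_cons, mul_inv, ← neg_sub a (x : ℂ), inv_neg]
      ring
    set H : ℂ → ℂ := fun z => Q.eval z + ∫ x, w x * (z - (x : ℂ))⁻¹ ∂μ with hH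
    have hdiff : ∀ z ∉ cSet K, DifferentiableAt ℂ H z := fun z hz =>
      Q.differentiableAt.add (differentiableAt_integral_mul_inv_sub hK hμ hz hw)
    have hopen : IsOpen (cSet K)ᶜ := (isClosed_cSet hK).isOpen_compl
    have hHan : AnalyticAt ℂ H a := by
      refine DifferentiableOn.analyticAt (s := (cSet K)ᶜ) (fun z hz => ?_) (hopen.mem_nhds ha)
      exact (hdiff z hz).differentiableWithinAt
    have hHa : H a = 0 := by
      by_contra hne
      have h0 : analyticOrderAt H a = 0 := analyticOrderAt_eq_zero.2 (Or.inr hne)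
      have hLe : L =ᶠ[nhds a] (fun z => (T.map fun b => z - b).prod) * H := by
        filter_upwards [hopen.mem_nhds ha] with z hz
        exact hLQ z hz
      have h1 := hord a
      rw [analyticOrderAt_congr hLe, analyticOrderAt_mul (analyticOrderAt_prod_sub T a).1 hHan,
        (analyticOrderAt_prod_sub T a).2, h0, Multiset.count_cons_self, add_zero] at h1
      have h2 : T.count a + 1 ≤ T.count a := by exact_mod_cast h1
      omega
    have hi : Integrable (fun x : ℝ => w x * (a - (x : ℂ))⁻¹) μ :=
      integrable_mul_inv_sub hK hμ ha hw
    refine ⟨Q /ₘ (X - C a), ?_, fun z hz => ?_, fun q hq => ?_⟩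
    · rw [Multiset.card_cons]
      by_cases hQ0 : Q /ₘ (X - C a) = 0
      · rw [hQ0, degree_zero]; exact WithBot.bot_lt_coe _
      · have hQne : Q ≠ 0 := by rintro rfl; simp at hQ0
        rw [degree_eq_natDegree hQ0, natDegree_divByMonic _ (monic_X_sub_C a), natDegree_X_sub_C]
        rw [degree_eq_natDegree hQne] at hQ
        have h1 : Q.natDegree < n - T.card := by exact_mod_cast hQ
        have h2 : Q.natDegree ≠ 0 := by
          intro h
          apply hQ0
          rw [divByMonic_eq_zero_iff (monic_X_sub_C a), degree_X_sub_C, degree_eq_natDegree hQne, h]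
          exact_mod_cast zero_lt_one
        exact_mod_cast (by omega : Q.natDegree - 1 < n - (T.card + 1))
    · rw [hLQ z hz]
      change _ * H z = _
      simp only [hw']
      rw [Multiset.map_cons, Multiset.prod_cons]
      have hQe : Q.eval z = (z - a) * (Q /ₘ (X - C a)).eval z + Q.eval a := by
        conv_lhs => rw [← modByMonic_add_div Q (X - C a), modByMonic_X_sub_C_eq_C_eval]
        simp only [eval_add, eval_mul, eval_sub, eval_X, eval_C]
        ring
      have hint : ∫ x, -(w x * (a - (x : ℂ))⁻¹) * (z - (x : ℂ))⁻¹ * (z - a) ∂μ =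
          (∫ x, w x * (z - (x : ℂ))⁻¹ ∂μ) - ∫ x, w x * (a - (x : ℂ))⁻¹ ∂μ := by
        rw [← integral_sub (integrable_mul_inv_sub hK hμ hz hw) hi]
        refine integral_congr_ae ?_
        filter_upwards [ae_mem_of_null_compl hμ] with x hx
        have h1 := sub_ofReal_ne_zero hz hx
        have h2 := sub_ofReal_ne_zero ha hx
        field_simp
        ring
      rw [integral_mul_const] at hint
      have hHz : H z = (z - a) * (Q /ₘ (X - C a)).eval z + Q.eval a +
          ∫ x, w x * (z - (x : ℂ))⁻¹ ∂μ := by rw [← hQe]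
      have hHa' : Q.eval a + ∫ x, w x * (a - (x : ℂ))⁻¹ ∂μ = 0 := hHa
      rw [hHz]
      linear_combination (T.map fun b => z - b).prod * hHa' -
        (T.map fun b => z - b).prod * hint
    · simp only [hw']
      rw [Multiset.card_cons] at hq
      rcases Nat.lt_or_ge T.card n with hlt | hge
      · have : q = 0 := by
          rw [Nat.sub_eq_zero_of_le hlt] at hq
          simpa using hq
        simp [this]
      · have hQ0 : Q = 0 := by
          rw [Nat.sub_eq_zero_of_le hge] at hQ
          simpa using hQ
        have hzero : ∫ x, w x * (a - (x : ℂ))⁻¹ ∂μ = 0 := by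
          have : Q.eval a + ∫ x, w x * (a - (x : ℂ))⁻¹ ∂μ = 0 := hHa
          simpa [hQ0] using this
        have hqe : ∀ y : ℂ, q.eval y = (y - a) * (q /ₘ (X - C a)).eval y + q.eval a := by
          intro y
          conv_lhs => rw [← modByMonic_add_div q (X - C a), modByMonic_X_sub_C_eq_C_eval]
          simp only [eval_add, eval_mul, eval_sub, eval_X, eval_C]
          ring
        have hqdeg : (q /ₘ (X - C a)).degree < ((T.card - n : ℕ) : WithBot ℕ) := by
          by_cases hq0 : q /ₘ (X - C a) = 0
          · rw [hq0, degree_zero]; exact WithBot.bot_lt_coe _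
          · have hqne : q ≠ 0 := by rintro rfl; simp at hq0
            rw [degree_eq_natDegree hq0, natDegree_divByMonic _ (monic_X_sub_C a),
              natDegree_X_sub_C]
            rw [degree_eq_natDegree hqne] at hq
            have h1 : q.natDegree < T.card + 1 - n := by exact_mod_cast hq
            have h2 : q.natDegree ≠ 0 := by
              intro h
              apply hq0
              rw [divByMonic_eq_zero_iff (monic_X_sub_C a), degree_X_sub_C,
                degree_eq_natDegree hqne, h]
              exact_mod_cast zero_lt_one
            exact_mod_cast (by omega : q.natDegree - 1 < T.card - n)
        have hcont : ContinuousOn (fun x : ℝ => (q /ₘ (X - C a)).eval (x : ℂ) * w x) K :=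
          ContinuousOn.mul (by fun_prop) hw
        calc ∫ x, q.eval (x : ℂ) * -(w x * (a - (x : ℂ))⁻¹) ∂μ
            = ∫ x, (q /ₘ (X - C a)).eval (x : ℂ) * w x - q.eval a * (w x * (a - (x : ℂ))⁻¹) ∂μ := by
              refine integral_congr_ae ?_
              filter_upwards [ae_mem_of_null_compl hμ] with x hx
              have h2 := sub_ofReal_ne_zero ha hx
              rw [hqe (x : ℂ)]
              field_simp
              ring
          _ = 0 := by
              rw [integral_sub (integrable_of_continuousOn hK hμ hcont) (hi.const_mul _),
                integral_const_mul, hzero, horth _ hqdeg]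
              simp

end ZeroRemoval

section SignChanges

/-- `x` is an increasing sequence in `S` along which `f` has the signs `+, -, +, …`. -/
def AlternatesOn (f : ℝ → ℝ) (S : Set ℝ) {d : ℕ} (x : Fin d → ℝ) : Prop :=
  StrictMono x ∧ (∀ i, x i ∈ S) ∧ ∀ i : Fin d, 0 < (-1) ^ (i : ℕ) * f (x i)

lemma AlternatesOn.cons {f : ℝ → ℝ} {S : Set ℝ} {d : ℕ} {x : Fin d → ℝ}
    (hx : AlternatesOn (-f) S x) {s : ℝ} (hs : s ∈ S) (hfs : 0 < f s) (hlt : ∀ i, s < x i) :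
    AlternatesOn f S (Fin.cons s x : Fin (d + 1) → ℝ) := by
  refine ⟨fun i j hij => ?_, fun i => ?_, fun i => ?_⟩
  · induction j using Fin.cases with
    | zero => exact absurd hij (Fin.not_lt_zero i)
    | succ j =>
      induction i using Fin.cases with
      | zero => simpa using hlt j
      | succ i => simpa using hx.1 (Fin.succ_lt_succ_iff.1 hij)
  · induction i using Fin.cases with
    | zero => simpa using hs
    | succ i => simpa using hx.2.1 i
  · induction i using Fin.cases with
    | zero => simpa using hfs
    | succ i =>
      have := hx.2.2 i
      simp only [Pi.neg_apply] at this
      simp only [Fin.cons_succ, Fin.val_succ, pow_succ]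
      linarith

lemma AlternatesOn.mul_neg {f : ℝ → ℝ} {S : Set ℝ} {d : ℕ} {x : Fin (d + 1) → ℝ}
    (hx : AlternatesOn f S x) (i : Fin d) : f (x i.castSucc) * f (x i.succ) < 0 := by
  have h := mul_pos (hx.2.2 i.castSucc) (hx.2.2 i.succ)
  simp only [Fin.val_castSucc, Fin.val_succ] at h
  have h1 : ((-1 : ℝ) ^ (i : ℕ)) * (-1) ^ (i : ℕ) = 1 := by
    rw [← mul_pow]; norm_num
  have h2 : (-1 : ℝ) ^ (i : ℕ) * f (x i.castSucc) * ((-1) ^ ((i : ℕ) + 1) * f (x i.succ)) =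
      -(f (x i.castSucc) * f (x i.succ)) := by
    rw [pow_succ]
    linear_combination -(f (x i.castSucc) * f (x i.succ)) * h1
  linarith

/-- A function without a long alternating sequence is made nonpositive by a polynomial of small
degree. -/
lemma exists_polynomial_mul_nonpos (d : ℕ) (f : ℝ → ℝ) {S : Set ℝ} (hS : BddBelow S)
    (h : ¬∃ x : Fin (d + 1) → ℝ, AlternatesOn f S x) :
    ∃ q : ℝ[X], q ≠ 0 ∧ q.natDegree ≤ d ∧ (∀ x ∈ S, q.eval x * f x ≤ 0) ∧
      ∀ x, (∀ s ∈ S, x ≤ s) → 0 ≤ q.eval x := by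
  induction d generalizing f S with
  | zero =>
    refine ⟨1, one_ne_zero, by simp, fun x hx => ?_, by simp⟩
    by_contra! hpos
    refine h ⟨fun _ => x, fun i j hij => absurd hij (by omega), fun _ => hx, fun i => ?_⟩
    simpa using hpos
  | succ d ih =>
    set T : Set ℝ := {x ∈ S | 0 < f x} with hT
    have hTb : BddBelow T := hS.mono fun x hx => hx.1
    rcases T.eq_empty_or_nonempty with hempty | hne
    · refine ⟨1, one_ne_zero, by simp, fun x hx => ?_, by simp⟩
      by_contra! hpos
      have : x ∈ T := ⟨hx, by simpa using hpos⟩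
      simp [hempty] at this
    · set c := sInf T with hc
      obtain ⟨q, hq0, hqd, hqS, hqpos⟩ := ih (-f) (S := S ∩ Ioi c) (hS.mono inter_subset_left) (by
        rintro ⟨x, hx⟩
        obtain ⟨s, hs, hsx⟩ := exists_lt_of_csInf_lt hne (hx.2.1 0).2
        refine h ⟨_, AlternatesOn.cons (x := x) ⟨hx.1, fun i => (hx.2.1 i).1, hx.2.2⟩ hs.1 hs.2
          fun i => hsx.trans_le (hx.1.monotone (Fin.zero_le i))⟩)
      have heval : ∀ x, (q * (C c - X)).eval x = q.eval x * (c - x) := by simp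
      have hne' : (C c - X : ℝ[X]) ≠ 0 := by
        rw [← neg_ne_zero, neg_sub]; exact X_sub_C_ne_zero c
      refine ⟨q * (C c - X), mul_ne_zero hq0 hne', ?_, fun x hx => ?_, fun x hx => ?_⟩
      · refine natDegree_mul_le.trans (Nat.add_le_add hqd ?_)
        rw [← natDegree_neg, neg_sub, natDegree_X_sub_C]
      · rw [heval]
        rcases lt_trichotomy x c with hlt | heq | hgt
        · have hfx : f x ≤ 0 := by
            by_contra! hpos
            exact absurd (csInf_le hTb ⟨hx, hpos⟩) (not_le.2 hlt)
          have h1 := hqpos x fun s hs => hlt.le.trans (le_of_lt hs.2)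
          exact mul_nonpos_of_nonneg_of_nonpos (mul_nonneg h1 (sub_nonneg.2 hlt.le)) hfx
        · simp [heq]
        · have h1 := hqS x ⟨hx, hgt⟩
          simp only [Pi.neg_apply] at h1
          nlinarith
      · have hxc : x ≤ c := le_csInf hne fun s hs => hx s hs.1
        rw [heval]
        exact mul_nonneg (hqpos x fun s hs => hx s hs.1) (sub_nonneg.2 hxc)

lemma exists_alternating_or_polynomial (d : ℕ) (f : ℝ → ℝ) {S : Set ℝ} (hS : BddBelow S)
    (hne : S.Nonempty) :
    (∃ x : Fin (d + 1) → ℝ, StrictMono x ∧ (∀ i, x i ∈ S) ∧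
      ∀ i : Fin d, f (x i.castSucc) * f (x i.succ) < 0) ∨
    ∃ q : ℝ[X], q ≠ 0 ∧ q.degree < (d : WithBot ℕ) ∧ ∀ x ∈ S, q.eval x * f x ≤ 0 := by
  rcases d with _ | d
  · obtain ⟨s, hs⟩ := hne
    exact Or.inl ⟨fun _ => s, fun i j hij => absurd hij (by omega), fun _ => hs, fun i => i.elim0⟩
  by_cases hp : ∃ x : Fin (d + 1) → ℝ, AlternatesOn f S x
  swap
  · obtain ⟨q, hq0, hqd, hq, -⟩ := exists_polynomial_mul_nonpos d f hS hp
    refine Or.inr ⟨q, hq0, ?_, hq⟩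
    rw [degree_eq_natDegree hq0]
    exact_mod_cast Nat.lt_succ_of_le hqd
  by_cases hm : ∃ x : Fin (d + 1) → ℝ, AlternatesOn (-f) S x
  swap
  · obtain ⟨q, hq0, hqd, hq, -⟩ := exists_polynomial_mul_nonpos d (-f) hS hm
    refine Or.inr ⟨-q, neg_ne_zero.2 hq0, ?_, fun x hx => ?_⟩
    · rw [degree_neg, degree_eq_natDegree hq0]
      exact_mod_cast Nat.lt_succ_of_le hqd
    · simpa using hq x hx
  left
  obtain ⟨x, hx⟩ := hp
  obtain ⟨y, hy⟩ := hm
  have hx0 : 0 < f (x 0) := by simpa using hx.2.2 0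
  have hy0 : 0 < -f (y 0) := by simpa using hy.2.2 0
  rcases lt_trichotomy (x 0) (y 0) with hlt | heq | hgt
  · have h := hy.cons (hx.2.1 0) hx0 fun i => hlt.trans_le (hy.1.monotone (Fin.zero_le i))
    exact ⟨_, h.1, h.2.1, h.mul_neg⟩
  · rw [heq] at hx0
    linarith
  · rw [← neg_neg f] at hx
    have h := hx.cons (hy.2.1 0) hy0 fun i => hgt.trans_le (hx.1.monotone (Fin.zero_le i))
    exact ⟨_, h.1, h.2.1, fun i => by simpa using h.mul_neg i⟩

/-- A function orthogonal to all polynomials of degree less than `d`, with respect to a measure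
times a nonvanishing weight, has `d` sign changes or vanishes on most of the support. -/
lemma exists_alternating_of_orthogonal {a b : ℝ} (hab : a < b) {μ : Measure ℝ} [IsFiniteMeasure μ]
    (hμ : μ (Icc a b)ᶜ = 0) {f v : ℝ → ℝ} (hf : ContinuousOn f (Icc a b))
    (hv : ContinuousOn v (Icc a b)) (hv0 : ∀ x ∈ Icc a b, v x ≠ 0) (d : ℕ)
    (horth : ∀ q : ℝ[X], q.degree < (d : WithBot ℕ) → ∫ x, q.eval x * f x * v x ∂μ = 0) :
    (∃ x : Fin (d + 1) → ℝ, StrictMono x ∧ (∀ i, x i ∈ Ioo a b) ∧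
      ∀ i : Fin d, f (x i.castSucc) * f (x i.succ) < 0) ∨
    ∃ q : ℝ[X], q ≠ 0 ∧ ∀ x ∈ SignedM.msupport μ, x ∈ Icc a b → q.eval x * f x = 0 := by
  refine (exists_alternating_or_polynomial d f bddBelow_Ioo (nonempty_Ioo.2 hab)).imp_right ?_
  rintro ⟨q, hq0, hqd, hq⟩
  refine ⟨q, hq0, fun x hx hxI => ?_⟩
  have hqf : ContinuousOn (fun x => q.eval x * f x) (Icc a b) := ContinuousOn.mul (by fun_prop) hf
  have hle : ∀ x ∈ Icc a b, q.eval x * f x ≤ 0 := by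
    intro y hy
    rw [← closure_Ioo hab.ne] at hy hqf
    exact ContinuousWithinAt.closure_le hy ((hqf y hy).mono subset_closure)
      continuousWithinAt_const hq
  have hcont : ContinuousOn (fun x => q.eval x * f x * v x) (Icc a b) := hqf.mul hv
  have hint : Integrable (fun x => q.eval x * f x * v x) μ :=
    integrable_of_continuousOn isCompact_Icc hμ hcont
  have hsign : (∀ x ∈ Icc a b, 0 < v x) ∨ ∀ x ∈ Icc a b, v x < 0 := by
    by_contra! hcon
    obtain ⟨⟨y, hy, hvy⟩, z, hz, hvz⟩ := hcon
    obtain ⟨t, ht, ht0⟩ := isPreconnected_Icc.intermediate_value hy hz hv ⟨hvy, hvz⟩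
    exact hv0 t ht ht0
  have hae : ∀ᵐ x ∂μ, q.eval x * f x * v x = 0 := by
    rcases hsign with hs | hs
    · have h0 : ∫ x, -(q.eval x * f x * v x) ∂μ = 0 := by rw [integral_neg, horth q hqd, neg_zero]
      have := (integral_eq_zero_iff_of_nonneg_ae (f := fun x => -(q.eval x * f x * v x)) (by
        filter_upwards [ae_mem_of_null_compl hμ] with y hy
        have := mul_nonpos_of_nonpos_of_nonneg (hle y hy) (hs y hy).le
        simpa using this) hint.neg).1 h0
      filter_upwards [this] with y hy
      simpa using hy
    · exact (integral_eq_zero_iff_of_nonneg_ae (by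
        filter_upwards [ae_mem_of_null_compl hμ] with y hy
        exact mul_nonneg_of_nonpos_of_nonpos (hle y hy) (hs y hy).le) hint).1 (horth q hqd)
  by_contra hne
  have hnhds : {y | y ∈ Icc a b → q.eval y * f y ≠ 0} ∈ nhds x := by
    have := (hqf x hxI).eventually_ne hne
    rwa [eventually_iff, mem_nhdsWithin_iff_eventually] at this
  obtain ⟨U, hU, hUo, hxU⟩ := mem_nhds_iff.1 hnhds
  refine hx U hUo hxU (measure_mono_null ?_ (ae_iff.1
    (hae.and (ae_mem_of_null_compl hμ))))
  rintro y hy ⟨h1, h2⟩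
  exact mul_ne_zero (hU hy h2) (hv0 y h2) h1

end SignChanges

lemma isPreconnected_compl_cSet_Icc (c d : ℝ) : IsPreconnected (cSet (Icc c d))ᶜ := by
  have h : (cSet (Icc c d))ᶜ = (({z : ℂ | 0 < z.im} ∪ {z : ℂ | z.re < c}) ∪ {z : ℂ | z.im < 0}) ∪
      (({z : ℂ | 0 < z.im} ∪ {z : ℂ | d < z.re})) := by
    ext z
    simp only [cSet, mem_compl_iff, mem_image, mem_Icc, mem_union, mem_ofPred_eq]
    constructor
    · intro hz
      by_contra! hcon
      exact hz ⟨z.re, ⟨hcon.1.1.2, hcon.2.2⟩,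
        Complex.ext rfl (le_antisymm hcon.1.2 hcon.1.1.1)⟩
    · rintro hz ⟨x, hx, rfl⟩
      simp only [Complex.ofReal_re, Complex.ofReal_im, lt_self_iff_false, false_or, or_false] at hz
      rcases hz with hz | hz <;> linarith [hx.1, hx.2]
  have h1 := (convex_halfSpace_im_gt 0).isPreconnected
  have h2 := (convex_halfSpace_re_lt c).isPreconnected
  have h3 := (convex_halfSpace_im_lt 0).isPreconnected
  have h4 := (convex_halfSpace_re_gt d).isPreconnected
  rw [h]
  refine IsPreconnected.union (Complex.I) ?_ ?_ (IsPreconnected.union ⟨c - 1, -1⟩ ?_ ?_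
    (IsPreconnected.union ⟨c - 1, 1⟩ ?_ ?_ h1 h2) h3) (IsPreconnected.union ⟨d + 1, 1⟩ ?_ ?_ h1 h4)
  all_goals simp

section Decomposition

lemma msupport_zero : SignedM.msupport 0 = ∅ := by
  ext x
  simp only [SignedM.msupport, mem_ofPred_eq, mem_empty_iff_false, iff_false]
  intro h
  exact h univ isOpen_univ (mem_univ x) (by simp)

lemma measure_compl_eq_zero {μ : Measure ℝ} {K : Set ℝ} (h : SignedM.msupport μ ⊆ K) :
    μ Kᶜ = 0 := by
  refine measure_null_of_locally_null _ fun x hx => ?_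
  have hx' : x ∉ SignedM.msupport μ := fun hs => hx (h hs)
  simp only [SignedM.msupport, mem_ofPred_eq, not_forall, not_not] at hx'
  obtain ⟨U, hU, hxU, hU0⟩ := hx'
  exact ⟨U, mem_nhdsWithin_of_mem_nhds (hU.mem_nhds hxU), hU0⟩

variable {s : SignedM} {Δ : Set ℝ}

lemma IsM.supp_subset (h : IsM s Δ) : s.supp ⊆ Δ := by
  rw [h.hullEq]
  exact fun x hx => ⟨csInf_le h.compactSupp.bddBelow hx, le_csSup h.compactSupp.bddAbove hx⟩

lemma IsM.isCompact (h : IsM s Δ) : IsCompact Δ := by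
  rw [h.hullEq]
  exact isCompact_Icc

lemma IsM.concentratedOn (h : IsM s Δ) : s.ConcentratedOn Δ :=
  ⟨h.posFinite, h.negFinite, measure_compl_eq_zero (subset_union_left.trans h.supp_subset),
    measure_compl_eq_zero (subset_union_right.trans h.supp_subset)⟩

lemma IsM.exists_Icc (h : IsM s Δ) : ∃ a b, a < b ∧ Δ = Icc a b := by
  refine ⟨_, _, ?_, h.hullEq⟩
  obtain ⟨x, hx, y, hy, hxy⟩ := h.infiniteSupp.nontrivial.exists_lt
  exact ((csInf_le h.compactSupp.bddBelow hx).trans_lt hxy).trans_le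
    (le_csSup h.compactSupp.bddAbove hy)

lemma IsM.exists_measure (h : IsM s Δ) : ∃ (μ : Measure ℝ) (ε : ℝ), IsFiniteMeasure μ ∧ ε ≠ 0 ∧
    μ Δᶜ = 0 ∧ (SignedM.msupport μ).Infinite ∧ SignedM.msupport μ ⊆ Δ ∧
    ∀ f : ℝ → ℂ, s.cintegral f = ε * ∫ x, f x ∂μ := by
  have hc := h.concentratedOn
  have hinf := h.infiniteSupp
  have hsub := h.supp_subset
  rw [SignedM.supp] at hinf hsub
  rcases h.constSign with h0 | h0
  · rw [h0, msupport_zero, empty_union] at hinf hsub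
    exact ⟨s.neg, -1, hc.negFinite, by norm_num, hc.neg_compl, hinf, hsub,
      fun f => by simp [SignedM.cintegral, h0]⟩
  · rw [h0, msupport_zero, union_empty] at hinf hsub
    exact ⟨s.pos, 1, hc.posFinite, by norm_num, hc.pos_compl, hinf, hsub,
      fun f => by simp [SignedM.cintegral, h0]⟩

lemma concentratedOn_nikSys {m : ℕ} {σ : ℕ → SignedM} {Δ : ℕ → Set ℝ}
    (hσ : ∀ j, 1 ≤ j → j ≤ m → IsM (σ j) (Δ j))
    (hdisj : ∀ j, 1 ≤ j → j + 1 ≤ m → Δ j ∩ Δ (j + 1) = ∅) {j k : ℕ} (hj : 1 ≤ j) (hjk : j ≤ k)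
    (hk : k ≤ m) : (nikSys σ j k).ConcentratedOn (Δ j) := by
  induction hjk using Nat.decreasingInduction with
  | self =>
    rw [nikSys, dif_neg (lt_irrefl k)]
    exact (hσ k hj hk).concentratedOn
  | of_succ j hlt ih =>
    have hs := ih (by omega)
    have hM := hσ j hj (by omega)
    rw [nikSys, dif_pos hlt]
    refine hM.concentratedOn.withDensityR hM.isCompact ((hs.continuousOn_cauchyR
      (hσ (j + 1) (by omega) (by omega)).isCompact).mono ?_)
    exact (disjoint_iff_inter_eq_empty.2 (hdisj j hj (by omega))).subset_compl_right

end Decomposition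

section Symmetry

lemma iteratedDeriv_conj {L : ℂ → ℂ}
    (hL : ∀ z, L (starRingEnd ℂ z) = starRingEnd ℂ (L z)) (i : ℕ) (z : ℂ) :
    iteratedDeriv i L (starRingEnd ℂ z) = starRingEnd ℂ (iteratedDeriv i L z) := by
  induction i generalizing z with
  | zero => simpa using hL z
  | succ i ih =>
    have h : starRingEnd ℂ ∘ iteratedDeriv i L ∘ starRingEnd ℂ = iteratedDeriv i L := by
      ext w
      simp [ih]
    have h1 := congrFun (deriv_conj_conj (f := iteratedDeriv i L)) (starRingEnd ℂ z)
    rw [h] at h1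
    rw [iteratedDeriv_succ, h1]
    simp

/-- The zeros of a real-symmetric function can be collected in a conjugation-invariant multiset. -/
lemma exists_symmetric_zeros {K : Set ℝ} {L : ℂ → ℂ}
    (hsymm : ∀ z, L (starRingEnd ℂ z) = starRingEnd ℂ (L z))
    (han : ∀ z ∉ cSet K, AnalyticAt ℂ L z) {t : Finset ℂ} {ord : ℂ → ℕ}
    (ht : ∀ z ∈ t, z ∉ cSet K) (hord : ∀ z ∈ t, ∀ i < ord z, iteratedDeriv i L z = 0) :
    ∃ T : Multiset ℂ, T.map (starRingEnd ℂ) = T ∧ ∑ z ∈ t, ord z ≤ T.card ∧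
      (∀ a ∈ T, a ∉ cSet K) ∧ ∀ a, (T.count a : ℕ∞) ≤ analyticOrderAt L a := by
  classical
  have hinj : Function.Injective (starRingEnd ℂ) := star_injective
  have hK : ∀ z, starRingEnd ℂ z ∈ cSet K → z ∈ cSet K := by
    rintro z ⟨x, hx, hxz⟩
    refine ⟨x, hx, hinj ?_⟩
    rw [← hxz]
    exact Complex.conj_ofReal x
  set T₀ : Multiset ℂ := ∑ z ∈ t, ord z • {z} with hT₀
  have hcount : ∀ a, T₀.count a = if a ∈ t then ord a else 0 := by
    intro a
    rw [hT₀, Multiset.count_sum']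
    simp [Multiset.count_nsmul, Multiset.count_singleton]
  have hmem : ∀ a ∈ T₀, a ∈ t := by
    intro a ha
    by_contra hat
    have := hcount a
    rw [if_neg hat, Multiset.count_eq_zero] at this
    exact this ha
  have hmap : ∀ a, (T₀.map (starRingEnd ℂ)).count a = T₀.count (starRingEnd ℂ a) := by
    intro a
    conv_lhs => rw [← Complex.conj_conj a]
    exact Multiset.count_map_eq_count' _ _ hinj _
  have hdouble : (T₀.map (starRingEnd ℂ)).map (starRingEnd ℂ) = T₀ := by
    simp [Multiset.map_map]
  have hoff : ∀ a ∈ T₀ ∪ T₀.map (starRingEnd ℂ), a ∉ cSet K := by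
    intro a ha
    rcases Multiset.mem_union.1 ha with h | h
    · exact ht a (hmem a h)
    · obtain ⟨b, hb, rfl⟩ := Multiset.mem_map.1 h
      exact fun hc => ht b (hmem b hb) (hK b hc)
  refine ⟨T₀ ∪ T₀.map (starRingEnd ℂ), ?_, ?_, hoff, fun a => ?_⟩
  · rw [Multiset.map_union hinj, hdouble, Multiset.union_comm]
  · refine le_trans (le_of_eq ?_) (Multiset.card_le_card Multiset.le_union_left)
    simp [hT₀]
  · by_cases ha : a ∈ T₀ ∪ T₀.map (starRingEnd ℂ)
    · rw [natCast_le_analyticOrderAt_iff_iteratedDeriv_eq_zero (han a (hoff a ha))]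
      intro i hi
      rw [Multiset.count_union, lt_max_iff, hmap, hcount, hcount] at hi
      rcases hi with hi | hi
      · split_ifs at hi with hat
        · exact hord a hat i hi
        · omega
      · split_ifs at hi with hat
        · have h := hord _ hat i hi
          rw [iteratedDeriv_conj hsymm] at h
          simpa using h
        · omega
    · rw [Multiset.count_eq_zero_of_notMem ha]
      simp

/-- If `P + f̂μ` has many zeros off `K`, then `f` times a nonvanishing weight is orthogonal to
polynomials. -/
lemma exists_weight_orthogonal {μ : Measure ℝ} [IsFiniteMeasure μ] {K : Set ℝ} (hK : IsCompact K)
    (hμ : μ Kᶜ = 0) {f : ℝ → ℝ} (hf : ContinuousOn f K) {n N : ℕ} {P : ℂ[X]}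
    (hP : P.degree < (n : WithBot ℕ)) {L : ℂ → ℂ}
    (hL : ∀ z ∉ cSet K, L z = P.eval z + ∫ x, (f x : ℂ) * (z - (x : ℂ))⁻¹ ∂μ)
    (hsymm : ∀ z, L (starRingEnd ℂ z) = starRingEnd ℂ (L z)) {t : Finset ℂ} {ord : ℂ → ℕ}
    (ht : ∀ z ∈ t, z ∉ cSet K) (hord : ∀ z ∈ t, ∀ i < ord z, iteratedDeriv i L z = 0)
    (hN : N ≤ ∑ z ∈ t, ord z) :
    ∃ v : ℝ → ℝ, ContinuousOn v K ∧ (∀ x ∈ K, v x ≠ 0) ∧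
      ∀ q : ℝ[X], q.degree < ((N - n : ℕ) : WithBot ℕ) → ∫ x, q.eval x * f x * v x ∂μ = 0 := by
  have hfc : ContinuousOn (fun x => (f x : ℂ)) K := Complex.continuous_ofReal.comp_continuousOn hf
  have hopen : IsOpen (cSet K)ᶜ := (isClosed_cSet hK).isOpen_compl
  have han : ∀ z ∉ cSet K, AnalyticAt ℂ L z := by
    intro z hz
    refine DifferentiableOn.analyticAt (s := (cSet K)ᶜ) (fun y hy => ?_) (hopen.mem_nhds hz)
    refine DifferentiableWithinAt.congr (DifferentiableAt.differentiableWithinAt ?_) hL (hL y hy)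
    exact P.differentiableAt.add (differentiableAt_integral_mul_inv_sub hK hμ hy hfc)
  obtain ⟨T, hTconj, hTN, hToff, hTord⟩ := exists_symmetric_zeros hsymm han ht hord
  obtain ⟨Q, -, -, horth⟩ := exists_quotient_by_zeros hK hμ hfc hP hL T hToff hTord
  set v : ℝ → ℝ := fun x => ((T.map fun b => (x : ℂ) - b).prod)⁻¹.re with hv
  have hreal : ∀ x : ℝ, ((T.map fun b => (x : ℂ) - b).prod)⁻¹ = v x := by
    intro x
    refine (Complex.conj_eq_iff_re.1 ?_).symm
    rw [map_inv₀, map_multiset_prod, Multiset.map_map]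
    congr 2
    conv_rhs => rw [← hTconj, Multiset.map_map]
    simp
  have hcont : ContinuousOn (fun x : ℝ => ((T.map fun b => (x : ℂ) - b).prod)⁻¹) K := by
    have := continuousOn_mul_prod_sub_inv (g := fun _ => 1) continuousOn_const hToff
    simpa only [one_mul] using this
  refine ⟨v, ?_, fun x hx h0 => ?_, fun q hq => ?_⟩
  · exact Complex.continuous_re.comp_continuousOn hcont
  · have h := hreal x
    rw [h0, Complex.ofReal_zero, inv_eq_zero, Multiset.prod_eq_zero_iff] at h
    obtain ⟨b, hb, hb0⟩ := Multiset.mem_map.1 h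
    exact hToff b hb ⟨x, hx, sub_eq_zero.1 hb0⟩
  · have h := horth (q.map (algebraMap ℝ ℂ)) (by
      rw [degree_map]
      exact hq.trans_le (by exact_mod_cast Nat.sub_le_sub_right (hN.trans hTN) n))
    have heval : ∀ x : ℝ, (q.map (algebraMap ℝ ℂ)).eval (x : ℂ) = q.eval x := fun x =>
      eval_map_apply (f := algebraMap ℝ ℂ) (p := q) x
    simp only [hreal, heval] at h
    rw [← Complex.ofReal_inj, ← integral_complex_ofReal, Complex.ofReal_zero, ← h]
    congr 1
    ext x
    push_cast
    ring

end Symmetry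

section LinearForm

/-- Moving all polynomial coefficients under the Cauchy integral. -/
lemma exists_polynomial_add_integral {μ : Measure ℝ} [IsFiniteMeasure μ] {K : Set ℝ}
    (hK : IsCompact K) (hμ : μ Kᶜ = 0) (s : Finset ℕ) {h : ℕ → ℝ → ℝ}
    (hh : ∀ k ∈ s, ContinuousOn (h k) K) {n : ℕ → ℕ} {p : ℕ → ℝ[X]}
    (hdeg : ∀ k ∈ s, (p k).degree < (n k : WithBot ℕ)) {d : ℕ} (hn : ∀ k ∈ s, n k ≤ d + 1) :
    ∃ Q : ℂ[X], Q.degree < (d : WithBot ℕ) ∧ ∀ z ∉ cSet K,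
      ∑ k ∈ s, aeval z (p k) * ∫ x, (h k x : ℂ) * (z - (x : ℂ))⁻¹ ∂μ =
        Q.eval z + ∫ x, ((∑ k ∈ s, (p k).eval x * h k x : ℝ) : ℂ) * (z - (x : ℂ))⁻¹ ∂μ := by
  have hc : ∀ k ∈ s, ContinuousOn (fun x => (h k x : ℂ)) K := fun k hk =>
    Complex.continuous_ofReal.comp_continuousOn (hh k hk)
  have hex : ∀ k ∈ s, ∃ Q : ℂ[X], Q.degree < ((n k - 1 : ℕ) : WithBot ℕ) ∧ ∀ z ∉ cSet K,
      aeval z (p k) * ∫ x, (h k x : ℂ) * (z - (x : ℂ))⁻¹ ∂μ =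
        Q.eval z + ∫ x, (((p k).eval x : ℝ) : ℂ) * (h k x : ℂ) * (z - (x : ℂ))⁻¹ ∂μ := by
    intro k hk
    obtain ⟨Q, hQ, hQe⟩ := exists_eval_mul_integral hK hμ (hc k hk) (n k)
      ((p k).map (algebraMap ℝ ℂ)) (by rw [degree_map]; exact hdeg k hk)
    refine ⟨Q, hQ, fun z hz => ?_⟩
    have heval : ∀ x : ℝ, ((p k).map (algebraMap ℝ ℂ)).eval (x : ℂ) = (p k).eval x := fun x =>
      eval_map_apply (f := algebraMap ℝ ℂ) (p := p k) x
    simpa only [heval, eval_map_algebraMap] using hQe z hz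
  choose! Q hQ hQe using hex
  refine ⟨∑ k ∈ s, Q k, ?_, fun z hz => ?_⟩
  · refine (degree_sum_le _ _).trans_lt ((Finset.sup_lt_iff (WithBot.bot_lt_coe d)).2 ?_)
    intro k hk
    have := hn k hk
    exact (hQ k hk).trans_le (Nat.cast_le.2 (by omega))
  · rw [Finset.sum_congr rfl fun k hk => hQe k hk z hz, Finset.sum_add_distrib,
      eval_finsetSum, ← integral_finsetSum]
    · congr 2
      ext x
      push_cast
      rw [Finset.sum_mul]
    · intro k hk
      refine integrable_mul_inv_sub hK hμ hz (ContinuousOn.mul ?_ (hc k hk))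
      exact (Complex.continuous_ofReal.comp (p k).continuous).continuousOn

end LinearForm

/-- Lemma on zero reduction: if the linear form `L = p₀ + Σ p_k ŝ_{1,k}` (with
`n₀ = max{n₀, n₁−1, …, n_m−1}`) has at least `|n|` zeros in `ℂ ∖ Δ₁` counting
multiplicities, then the reduced form `p₁ + Σ_{k=2}^m p_k ŝ_{2,k}` either vanishes
identically on `ℂ ∖ Δ₂` or has at least `|n| − n₀` sign changes in the interior of `Δ₁`
(and in particular at least `|n| − n₀` zeros in `ℂ ∖ Δ₂`). -/
theorem stmt5
    (m : ℕ) (hm : 1 ≤ m)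
    (σ : ℕ → SignedM) (Δ : ℕ → Set ℝ)
    (hσ : ∀ j, 1 ≤ j → j ≤ m → IsM (σ j) (Δ j))
    (hdisj : ∀ j, 1 ≤ j → j + 1 ≤ m → Δ j ∩ Δ (j + 1) = ∅)
    (n : ℕ → ℕ)
    (p : ℕ → Polynomial ℝ)
    (hdeg : ∀ k ≤ m, (p k).degree < (n k : WithBot ℕ))
    (hn0 : ∀ k, 1 ≤ k → k ≤ m → n k ≤ n 0 + 1)
    (N : ℕ) (hN : N = ∑ j ∈ Finset.range (m + 1), n j)
    (L : ℂ → ℂ)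
    (hL : ∀ z, L z = aeval z (p 0) +
      ∑ k ∈ Finset.Icc 1 m, aeval z (p k) * (nikSys σ 1 k).cauchy z)
    (hzeros : ∃ (t : Finset ℂ) (ord : ℂ → ℕ),
      (∀ z ∈ t, z ∉ cSet (Δ 1)) ∧
      (∀ z ∈ t, ∀ i < ord z, iteratedDeriv i L z = 0) ∧
      N ≤ ∑ z ∈ t, ord z)
    (Rc : ℂ → ℂ)
    (hRc : ∀ z, Rc z = aeval z (p 1) +
      ∑ k ∈ Finset.Icc 2 m, aeval z (p k) * (nikSys σ 2 k).cauchy z)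
    (Rr : ℝ → ℝ)
    (hRr : ∀ x, Rr x = eval x (p 1) +
      ∑ k ∈ Finset.Icc 2 m, eval x (p k) * (nikSys σ 2 k).cauchyR x) :
    (∀ z : ℂ, z ∉ cSet (Δ 2) → Rc z = 0) ∨
      ((∃ x : Fin (N - n 0 + 1) → ℝ, StrictMono x ∧
          (∀ i, x i ∈ interior (Δ 1)) ∧
          (∀ i : Fin (N - n 0), Rr (x i.castSucc) * Rr (x i.succ) < 0)) ∧
        ∃ (t : Finset ℂ) (ord : ℂ → ℕ),
          (∀ z ∈ t, z ∉ cSet (Δ 2)) ∧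
          (∀ z ∈ t, ∀ i < ord z, iteratedDeriv i Rc z = 0) ∧
          N - n 0 ≤ ∑ z ∈ t, ord z) := by
  obtain ⟨a, b, hab, hΔ⟩ := (hσ 1 le_rfl hm).exists_Icc
  have hK : IsCompact (Δ 1) := (hσ 1 le_rfl hm).isCompact
  obtain ⟨μ, ε, _, hε, hμ, hinf, hsub, hint⟩ := (hσ 1 le_rfl hm).exists_measure
  have hΔ2 : ∀ k ∈ Finset.Icc 2 m, IsM (σ 2) (Δ 2) ∧ Δ 1 ⊆ (Δ 2)ᶜ ∧
      (nikSys σ 2 k).ConcentratedOn (Δ 2) := by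
    intro k hk
    have hk' := Finset.mem_Icc.1 hk
    exact ⟨hσ 2 one_le_two (by omega),
      (disjoint_iff_inter_eq_empty.2 (hdisj 1 le_rfl (by omega))).subset_compl_right,
      concentratedOn_nikSys hσ hdisj one_le_two hk'.1 hk'.2⟩
  have hRcR : ∀ x : ℝ, Rc x = Rr x := by
    intro x
    rw [hRc, hRr]
    push_cast
    congr 1
    · exact aeval_algebraMap_apply_eq_algebraMap_eval x (p 1)
    · refine Finset.sum_congr rfl fun k _ => ?_
      rw [SignedM.cauchy_ofReal]
      congr 1
      exact aeval_algebraMap_apply_eq_algebraMap_eval x (p k)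
  have hRrc : ContinuousOn Rr (Δ 1) := by
    rw [funext hRr]
    refine (p 1).continuous.continuousOn.add (continuousOn_finsetSum _ fun k hk => ?_)
    obtain ⟨hM, hd, hc⟩ := hΔ2 k hk
    exact (p k).continuous.continuousOn.mul ((hc.continuousOn_cauchyR hM.isCompact).mono hd)
  have hsymm : ∀ z, L (starRingEnd ℂ z) = starRingEnd ℂ (L z) := by
    intro z
    simp only [hL, map_add, map_sum, map_mul, SignedM.cauchy_conj, aeval_conj]
  set h : ℕ → ℝ → ℝ := fun k x => if k = 1 then 1 else (nikSys σ 2 k).cauchyR x with hh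
  have hsplit : Finset.Icc 1 m = insert 1 (Finset.Icc 2 m) := by
    ext k
    simp only [Finset.mem_Icc, Finset.mem_insert]
    omega
  have hhc : ∀ k ∈ Finset.Icc 1 m, ContinuousOn (h k) (Δ 1) := by
    intro k hk
    by_cases hk1 : k = 1
    · simp only [hh, hk1, if_true]
      exact continuousOn_const
    · obtain ⟨hM, hd, hc⟩ := hΔ2 k (by simp only [Finset.mem_Icc] at hk ⊢; omega)
      simp only [hh, hk1, if_false]
      exact (hc.continuousOn_cauchyR hM.isCompact).mono hd
  have hRh : ∀ x, Rr x = ∑ k ∈ Finset.Icc 1 m, (p k).eval x * h k x := by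
    intro x
    rw [hRr, hsplit, Finset.sum_insert (by simp)]
    congr 1
    · simp [hh]
    · refine Finset.sum_congr rfl fun k hk => ?_
      have : k ≠ 1 := by have := Finset.mem_Icc.1 hk; omega
      simp [hh, this]
  have hcauchy : ∀ k ∈ Finset.Icc 1 m, ∀ z ∉ cSet (Δ 1),
      (nikSys σ 1 k).cauchy z = ε * ∫ x, (h k x : ℂ) * (z - (x : ℂ))⁻¹ ∂μ := by
    intro k hk z hz
    by_cases hk1 : k = 1
    · rw [hk1, nikSys, dif_neg (lt_irrefl 1), SignedM.cauchy, hint]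
      simp [hh]
    · have hk2 : k ∈ Finset.Icc 2 m := by simp only [Finset.mem_Icc] at hk ⊢; omega
      obtain ⟨hM, hd, hc⟩ := hΔ2 k hk2
      have hcont := continuousOn_mul_inv_sub hz (w := fun _ => 1) continuousOn_const
      simp only [one_mul] at hcont
      rw [nikSys, dif_pos (by have := Finset.mem_Icc.1 hk2; omega), SignedM.nik, SignedM.cauchy,
        (hσ 1 le_rfl hm).concentratedOn.cintegral_withDensityR hK hc.measurable_cauchyR
          ((hc.continuousOn_cauchyR hM.isCompact).mono hd) hcont, hint]
      simp [hh, hk1]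
  obtain ⟨Q, hQ, hQe⟩ := exists_polynomial_add_integral hK hμ (Finset.Icc 1 m) hhc
    (fun k hk => hdeg k (Finset.mem_Icc.1 hk).2)
    (fun k hk => hn0 k (Finset.mem_Icc.1 hk).1 (Finset.mem_Icc.1 hk).2)
  have hLrep : ∀ z ∉ cSet (Δ 1), L z = ((p 0).map (algebraMap ℝ ℂ) + C (ε : ℂ) * Q).eval z +
      ∫ x, ((ε * Rr x : ℝ) : ℂ) * (z - (x : ℂ))⁻¹ ∂μ := by
    intro z hz
    have h1 : ∑ k ∈ Finset.Icc 1 m, aeval z (p k) * (nikSys σ 1 k).cauchy z =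
        ε * ∑ k ∈ Finset.Icc 1 m, aeval z (p k) * ∫ x, (h k x : ℂ) * (z - (x : ℂ))⁻¹ ∂μ := by
      rw [Finset.mul_sum]
      refine Finset.sum_congr rfl fun k hk => ?_
      rw [hcauchy k hk z hz]
      ring
    rw [hL, h1, hQe z hz]
    simp only [← hRh, Complex.ofReal_mul, mul_assoc, integral_const_mul, eval_add, eval_mul, eval_C,
      eval_map_algebraMap]
    ring
  have hPdeg : ((p 0).map (algebraMap ℝ ℂ) + C (ε : ℂ) * Q).degree < (n 0 : WithBot ℕ) := by
    refine (degree_add_le _ _).trans_lt (max_lt ?_ ?_)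
    · rw [degree_map]
      exact hdeg 0 (Nat.zero_le m)
    · rwa [degree_C_mul (Complex.ofReal_ne_zero.2 hε)]
  obtain ⟨t, ord, ht, hord, htN⟩ := hzeros
  obtain ⟨v, hvc, hv0, horth⟩ := exists_weight_orthogonal hK hμ (hRrc.const_smul ε) hPdeg hLrep hsymm
    ht hord htN
  rw [hΔ] at hμ hRrc hvc hv0
  have hpoly : m = 1 → ∀ x, Rr x = (p 1).eval x := by
    rintro rfl x
    rw [hRr, Finset.Icc_eq_empty (by norm_num), Finset.sum_empty, add_zero]
  have hpoly_zero : m = 1 → p 1 = 0 → ∀ z, Rc z = 0 := by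
    rintro rfl h0 z
    rw [hRc, h0, Finset.Icc_eq_empty (by norm_num), Finset.sum_empty, map_zero, add_zero]
  rcases exists_alternating_of_orthogonal hab hμ hRrc (hvc.const_smul ε)
    (fun x hx => mul_ne_zero hε (hv0 x hx)) (N - n 0) (fun q hq => by
      rw [← horth q hq]
      congr 1
      ext x
      simp only [Pi.smul_apply, smul_eq_mul]
      ring) with ⟨x, hxm, hxI, hxalt⟩ | ⟨q, hq0, hq⟩
  · have hzero : ∀ i : Fin (N - n 0), ∃ y ∈ Ioo (x i.castSucc) (x i.succ), Rr y = 0 := by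
      intro i
      have hlt : x i.castSucc < x i.succ := hxm i.castSucc_lt_succ
      have hc : ContinuousOn Rr (Icc (x i.castSucc) (x i.succ)) :=
        hRrc.mono (Icc_subset_Icc (hxI _).1.le (hxI _).2.le)
      rcases mul_neg_iff.1 (hxalt i) with hs | hs
      · exact intermediate_value_Ioo' hlt.le hc ⟨hs.2, hs.1⟩
      · exact intermediate_value_Ioo hlt.le hc ⟨hs.1, hs.2⟩
    choose y hyI hy0 using hzero
    have hym : StrictMono y := by
      intro i j hij
      have : x i.succ ≤ x j.castSucc := hxm.monotone (Fin.le_def.2 (by simpa using hij))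
      exact ((hyI i).2.trans_le this).trans (hyI j).1
    by_cases hm1 : m = 1
    · left
      refine fun z _ => hpoly_zero hm1 ?_ z
      subst hm1
      by_contra hp1
      have hN' : N - n 0 = n 1 := by
        rw [hN]
        simp [Finset.sum_range_succ]
      have hcard := Polynomial.card_roots' (p 1)
      have hle : (Finset.univ.image y).val ≤ (p 1).roots := by
        rw [Finset.val_le_iff_val_subset]
        intro w hw
        have hw' : w ∈ Finset.univ.image y := hw
        obtain ⟨i, -, rfl⟩ := Finset.mem_image.1 hw'
        rw [mem_roots hp1, IsRoot, ← hpoly rfl]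
        exact hy0 i
      have h1 := Multiset.card_le_card hle
      rw [Finset.card_val, Finset.card_image_of_injective _ hym.injective, Finset.card_univ,
        Fintype.card_fin, hN'] at h1
      have h2 := hdeg 1 le_rfl
      rw [degree_eq_natDegree hp1] at h2
      have h3 : (p 1).natDegree < n 1 := by exact_mod_cast h2
      omega
    · right
      have hyinj : Function.Injective fun i => (y i : ℂ) :=
        Complex.ofReal_injective.comp hym.injective
      refine ⟨⟨x, hxm, fun i => by rw [hΔ, interior_Icc]; exact hxI i, hxalt⟩,
        Finset.univ.image fun i => (y i : ℂ), fun _ => 1, ?_, ?_, ?_⟩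
      · intro z hz
        obtain ⟨i, -, rfl⟩ := Finset.mem_image.1 hz
        rw [ofReal_mem_cSet]
        refine (hΔ2 2 (Finset.mem_Icc.2 ⟨le_rfl, by omega⟩)).2.1 ?_
        rw [hΔ]
        exact ⟨((hxI _).1.trans (hyI i).1).le, ((hyI i).2.trans (hxI _).2).le⟩
      · intro z hz i hi
        obtain ⟨j, -, rfl⟩ := Finset.mem_image.1 hz
        rw [Nat.lt_one_iff.1 hi, iteratedDeriv_zero, hRcR, hy0, Complex.ofReal_zero]
      · rw [Finset.sum_const, smul_eq_mul, mul_one, Finset.card_image_of_injective _ hyinj,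
          Finset.card_univ, Fintype.card_fin]
  · left
    have hZinf : (SignedM.msupport μ \ {x | q.IsRoot x}).Infinite :=
      hinf.sdiff (finite_setOfPred_isRoot hq0)
    have hZ0 : ∀ x ∈ SignedM.msupport μ \ {x | q.IsRoot x}, Rr x = 0 := by
      intro x hx
      exact (mul_eq_zero.1 (hq x hx.1 (hΔ ▸ hsub hx.1))).resolve_left hx.2
    by_cases hm1 : m = 1
    · refine fun z _ => hpoly_zero hm1 ?_ z
      refine eq_zero_of_infinite_isRoot _ (hZinf.mono fun x hx => ?_)
      change (p 1).eval x = 0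
      rw [← hpoly hm1]
      exact hZ0 x hx
    · obtain ⟨hM, hd, -⟩ := hΔ2 2 (Finset.mem_Icc.2 ⟨le_rfl, by omega⟩)
      obtain ⟨c, d, -, hcd⟩ := hM.exists_Icc
      have hopen : IsOpen (cSet (Δ 2))ᶜ := (isClosed_cSet hM.isCompact).isOpen_compl
      have han : AnalyticOnNhd ℂ Rc (cSet (Δ 2))ᶜ := by
        refine DifferentiableOn.analyticOnNhd (fun z hz => ?_) hopen
        rw [funext hRc]
        refine DifferentiableAt.differentiableWithinAt ?_
        refine (p 1).differentiable_aeval.differentiableAt.add (DifferentiableAt.fun_sum fun k hk => ?_)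
        exact (p k).differentiable_aeval.differentiableAt.mul
          ((hΔ2 k hk).2.2.differentiableAt_cauchy hM.isCompact hz)
      obtain ⟨x₀, hx₀, hacc⟩ := hZinf.exists_accPt_of_subset_isCompact hK
        (sdiff_subset.trans hsub)
      have hx₀' : (x₀ : ℂ) ∈ (cSet (Δ 2))ᶜ := mt ofReal_mem_cSet.1 (hd hx₀)
      refine han.eqOn_zero_of_preconnected_of_frequently_eq_zero
        (by rw [hcd]; exact isPreconnected_compl_cSet_Icc c d) hx₀' ?_
      have hfreq : ∃ᶠ x in nhdsWithin x₀ {x₀}ᶜ, Rr x = 0 :=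
        (accPt_iff_frequently_nhdsNE.1 hacc).mono hZ0
      have htend : Tendsto (fun x : ℝ => (x : ℂ)) (nhdsWithin x₀ {x₀}ᶜ)
          (nhdsWithin (x₀ : ℂ) {(x₀ : ℂ)}ᶜ) :=
        Complex.continuous_ofReal.continuousAt.continuousWithinAt.tendsto_nhdsWithin
          fun x hx => by simpa using hx
      refine htend.frequently (hfreq.mono fun x hx => ?_)
      rw [hRcR, hx, Complex.ofReal_zero]
end
end
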